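/- arXiv:2110.09555 — 2 statements merged into one kernel-verified Lean document; each statement's English description precedes it below -/
import Mathlib

section
/- Let d ≥ 1, q_1, q_2 ∈ (1, ∞), β with 0 < β ≤ d/q_1 + 2/q_2, α ∈ (0, β), and let r_1, r_2 satisfy r_i(β − α) = q_i β for i = 1, 2. Then there exists a constant N = N(d, q_1, q_2, α, β) such that for every measurable f ≥ 0 on ℝ^{d+1} one has ‖P_α f‖_{E_{r_1, r_2, β−α}} ≤ N ‖f‖_{E_{q_1, q_2, β}}. -/
open MeasureTheory Set ENNReal Filter

noncomputable section

/-- Euclidean space `ℝ^d`. -/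
abbrev Ed (d : ℕ) := EuclideanSpace ℝ (Fin d)

/-- Points of `ℝ^{d+1}`: `z = (t, x)`. -/
abbrev Pt (d : ℕ) := ℝ × Ed d

/-- The parabolic cylinder `C_ρ(t,x)`. -/
def pCyl (d : ℕ) (ρ : ℝ) (z : Pt d) : Set (Pt d) :=
  {w | dist z.2 w.2 < ρ ∧ z.1 ≤ w.1 ∧ w.1 < z.1 + ρ ^ 2}

/-- The average `⨍_{C_ρ(z)} f`. -/
def pAvg (d : ℕ) (ρ : ℝ) (z : Pt d) (f : Pt d → ℝ≥0∞) : ℝ≥0∞ :=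
  (volume (pCyl d ρ z))⁻¹ * ∫⁻ w in pCyl d ρ z, f w

/-- The fractional maximal function `M_β f`. -/
def Mbeta (d : ℕ) (β : ℝ) (f : Pt d → ℝ≥0∞) (z : Pt d) : ℝ≥0∞ :=
  ⨆ (ρ : ℝ) (_ : 0 < ρ), ENNReal.ofReal (ρ ^ β) * pAvg d ρ z f

/-- The kernel `p_α(s, r)`. -/
def pKer (d : ℕ) (α : ℝ) (s r : ℝ) : ℝ≥0∞ :=
  if 0 < s then ENNReal.ofReal (s ^ (-(((d : ℝ) + 2 - α) / 2)) * Real.exp (-(r ^ 2) / s)) else 0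

/-- The parabolic potential `P_α f`. -/
def Palpha (d : ℕ) (α : ℝ) (f : Pt d → ℝ≥0∞) (z : Pt d) : ℝ≥0∞ :=
  ∫⁻ w : Pt d, pKer d α w.1 ‖w.2‖ * f (z.1 + w.1, z.2 + w.2)

/-- The parabolic Morrey norm `‖f‖_{E_{p,β}(Q)}`. -/
def MorreyNorm (d : ℕ) (p β : ℝ) (Q : Set (Pt d)) (f : Pt d → ℝ≥0∞) : ℝ≥0∞ :=
  ⨆ (ρ : ℝ) (_ : 0 < ρ) (z : Pt d) (_ : z ∈ Q),
    ENNReal.ofReal (ρ ^ β) * (pAvg d ρ z fun w => Q.indicator f w ^ p) ^ (1 / p)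

/-- The `L_p`-norm on `ℝ^{d+1}`. -/
def LpNormE (d : ℕ) (p : ℝ) (f : Pt d → ℝ≥0∞) : ℝ≥0∞ :=
  (∫⁻ z : Pt d, f z ^ p) ^ (1 / p)

/-- The mixed norm `‖f‖_{L_{q₁,q₂}}`. -/
def MixedNorm (d : ℕ) (q₁ q₂ : ℝ) (f : Pt d → ℝ≥0∞) : ℝ≥0∞ :=
  (∫⁻ t : ℝ, (∫⁻ x : Ed d, f (t, x) ^ q₁) ^ (q₂ / q₁)) ^ (1 / q₂)

/-- The normalized mixed norm `‖f‖_{L_{q₁,q₂}(Γ)}`. -/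
def MixedNormOn (d : ℕ) (q₁ q₂ : ℝ) (Γ : Set (Pt d)) (f : Pt d → ℝ≥0∞) : ℝ≥0∞ :=
  (MixedNorm d q₁ q₂ (Γ.indicator 1))⁻¹ * MixedNorm d q₁ q₂ (Γ.indicator f)

/-- The mixed-norm parabolic Morrey norm `‖f‖_{E_{q₁,q₂,β}(Q)}`. -/
def MixedMorrey (d : ℕ) (q₁ q₂ β : ℝ) (Q : Set (Pt d)) (f : Pt d → ℝ≥0∞) : ℝ≥0∞ :=
  ⨆ (ρ : ℝ) (_ : 0 < ρ) (z : Pt d) (_ : z ∈ Q),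
    ENNReal.ofReal (ρ ^ β) * MixedNormOn d q₁ q₂ (pCyl d ρ z) (Q.indicator f)

/-- The symmetric parabolic maximal function `M̂ f`. -/
def pMax (d : ℕ) (f : Pt d → ℝ≥0∞) (z : Pt d) : ℝ≥0∞ :=
  ⨆ (r : ℝ) (_ : 0 < r) (w : Pt d) (_ : z ∈ pCyl d r w), pAvg d r w f

/-- The time derivative `∂_t u`. -/
def timeDeriv (d : ℕ) (u : Pt d → ℝ) (z : Pt d) : ℝ :=
  fderiv ℝ u z ((1 : ℝ), (0 : Ed d))

/-- The spatial partial derivative `D_i u`. -/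
def spDeriv (d : ℕ) (i : Fin d) (u : Pt d → ℝ) (z : Pt d) : ℝ :=
  fderiv ℝ u z ((0 : ℝ), EuclideanSpace.single i (1 : ℝ))

/-- The Euclidean norm of the spatial gradient `|Du|`. -/
def gradNorm (d : ℕ) (u : Pt d → ℝ) (z : Pt d) : ℝ :=
  Real.sqrt (∑ i : Fin d, spDeriv d i u z ^ 2)

/-- The spatial Laplacian `Δu`. -/
def lap (d : ℕ) (u : Pt d → ℝ) (z : Pt d) : ℝ :=
  ∑ i : Fin d, spDeriv d i (spDeriv d i u) z

/-- The (Frobenius) norm of the spatial Hessian `|D²u|`. -/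
def hessNorm (d : ℕ) (u : Pt d → ℝ) (z : Pt d) : ℝ :=
  Real.sqrt (∑ i : Fin d, ∑ j : Fin d, spDeriv d i (spDeriv d j u) z ^ 2)

/-! ### Scalar integrals -/

lemma sc_Ioc (a : ℝ) (ha : 0 < a) (R : ℝ) (hR : 0 ≤ R) :
    ∫⁻ x in Ioc 0 R, ENNReal.ofReal (x ^ (a - 1)) = ENNReal.ofReal (R ^ a / a) := by
  rw [← ofReal_integral_eq_lintegral_ofReal]
  · rw [← intervalIntegral.integral_of_le hR, integral_rpow (Or.inl (by linarith))]
    simp [Real.zero_rpow ha.ne']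
  · have := intervalIntegral.intervalIntegrable_rpow' (a := 0) (b := R) (r := a - 1) (by linarith)
    exact (intervalIntegrable_iff_integrableOn_Ioc_of_le hR).1 this
  · refine (ae_restrict_iff' measurableSet_Ioc).2 (Eventually.of_forall fun x hx => ?_)
    exact Real.rpow_nonneg hx.1.le _

lemma sc_Ioi (a : ℝ) (ha : 0 < a) (R : ℝ) (hR : 0 < R) :
    ∫⁻ x in Ioi R, ENNReal.ofReal (x ^ (-a - 1)) = ENNReal.ofReal (R ^ (-a) / a) := by
  rw [← ofReal_integral_eq_lintegral_ofReal]
  · rw [integral_Ioi_rpow_of_lt (by linarith) hR]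
    congr 1
    rw [show -a - 1 + 1 = -a by ring, neg_div_neg_eq]
  · exact integrableOn_Ioi_rpow_of_lt (by linarith) hR
  · refine (ae_restrict_iff' measurableSet_Ioi).2 (Eventually.of_forall fun x hx => ?_)
    exact Real.rpow_nonneg (hR.trans hx).le _

lemma sc_cake (q : ℝ) (hq : 0 < q) (a : ℝ≥0∞) :
    ∫⁻ x in Ioi (0:ℝ), (if ENNReal.ofReal x < a then ENNReal.ofReal (x ^ (q - 1)) else 0)
      = ENNReal.ofReal (1 / q) * a ^ q := by
  have key : ∀ R : ℝ, 0 ≤ R →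
      ∫⁻ x in Ioi (0:ℝ), (if ENNReal.ofReal x < ENNReal.ofReal R then
        ENNReal.ofReal (x ^ (q - 1)) else 0) = ENNReal.ofReal (1 / q) * (ENNReal.ofReal R) ^ q := by
    intro R hR
    have h1 : ∫⁻ x in Ioi (0:ℝ), (if ENNReal.ofReal x < ENNReal.ofReal R then
        ENNReal.ofReal (x ^ (q - 1)) else 0)
        = ∫⁻ x in Ioi (0:ℝ), (Iio R).indicator (fun x => ENNReal.ofReal (x ^ (q - 1))) x := by
      refine setLIntegral_congr_fun measurableSet_Ioi fun x hx => ?_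
      have hx' : (0:ℝ) < x := hx
      simp only [indicator, mem_Iio, ENNReal.ofReal_lt_ofReal_iff_of_nonneg hx'.le]
    rw [h1, lintegral_indicator measurableSet_Iio, Measure.restrict_restrict measurableSet_Iio,
      Iio_inter_Ioi, setLIntegral_congr Ioo_ae_eq_Ioc, sc_Ioc q hq R hR,
      ENNReal.ofReal_rpow_of_nonneg hR hq.le, ← ENNReal.ofReal_mul (by positivity)]
    congr 1; ring
  by_cases ha : a = ∞
  · subst ha
    rw [ENNReal.top_rpow_of_pos hq, ENNReal.mul_top (by simpa using hq)]
    refine ENNReal.eq_top_of_forall_nnreal_le fun r => ?_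
    have h2 := key ((q * r) ^ (1 / q)) (by positivity)
    calc (r : ℝ≥0∞) = ENNReal.ofReal (1 / q) * (ENNReal.ofReal ((q * r) ^ (1 / q))) ^ q := by
          rw [ENNReal.ofReal_rpow_of_nonneg (by positivity) hq.le, ← Real.rpow_mul (by positivity),
            ← ENNReal.ofReal_mul (by positivity), one_div_mul_cancel hq.ne', Real.rpow_one]
          rw [show 1 / q * (q * (r:ℝ)) = r by field_simp]
          simp
      _ ≤ _ := by
          rw [← h2]
          refine lintegral_mono fun x => ?_
          simp only [ENNReal.ofReal_lt_top, if_true]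
          split_ifs <;> simp
  · have := key a.toReal ENNReal.toReal_nonneg
    rwa [ENNReal.ofReal_toReal ha] at this

/-! ### Vitali and Marcinkiewicz -/

lemma vitali_weak {X : Type*} [TopologicalSpace X] [TopologicalSpace.SeparableSpace X]
    [MeasurableSpace X] (μ ν : Measure X) (B Bs : ℤ → X → Set X)
    (hBm : ∀ k x, MeasurableSet (B k x)) (hBi : ∀ k x, (interior (B k x)).Nonempty)
    (hBs : ∀ k x k' x', k ≤ k' → (B k x ∩ B k' x').Nonempty → B k x ⊆ Bs k' x')
    (l : ℝ≥0∞) (G : X → ℝ≥0∞) (t : Set (ℤ × X)) (n : ℤ) (hn : ∀ a ∈ t, a.1 ≤ n)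
    (ht : ∀ a ∈ t, l * ν (Bs a.1 a.2) ≤ ∫⁻ y in B a.1 a.2, G y ∂μ) :
    l * ν (⋃ a ∈ t, B a.1 a.2) ≤ ∫⁻ y, G y ∂μ := by
  obtain ⟨u, hut, hud, hu⟩ := Vitali.exists_disjoint_subfamily_covering_enlargement
    (fun a : ℤ × X => B a.1 a.2) t (fun a => (2:ℝ) ^ a.1) (3/2) (by norm_num)
    (fun a _ => by positivity) ((2:ℝ) ^ n)
    (fun a ha => zpow_le_zpow_right₀ (by norm_num) (hn a ha))
    (fun a _ => (hBi a.1 a.2).mono interior_subset)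
  have huc : u.Countable := hud.countable_of_nonempty_interior fun a _ => hBi a.1 a.2
  have hsub : (⋃ a ∈ t, B a.1 a.2) ⊆ ⋃ b ∈ u, Bs b.1 b.2 := by
    refine iUnion₂_subset fun a ha => ?_
    obtain ⟨b, hb, hne, hd⟩ := hu a ha
    have hk : a.1 ≤ b.1 := by
      by_contra hcon
      have h1 : b.1 + 1 ≤ a.1 := by omega
      have h2 : (2:ℝ) ^ (b.1 + 1) ≤ (2:ℝ) ^ a.1 := zpow_le_zpow_right₀ (by norm_num) h1
      rw [zpow_add₀ (by norm_num), zpow_one] at h2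
      have h3 : (0:ℝ) < (2:ℝ) ^ b.1 := by positivity
      linarith
    exact (hBs _ _ _ _ hk hne).trans (subset_biUnion_of_mem (u := fun b : ℤ × X => Bs b.1 b.2) hb)
  have : Countable u := huc.to_subtype
  calc l * ν (⋃ a ∈ t, B a.1 a.2) ≤ l * ∑' b : u, ν (Bs b.1.1 b.1.2) := by
        gcongr
        refine (measure_mono hsub).trans ?_
        rw [biUnion_eq_iUnion]
        exact measure_iUnion_le _
    _ = ∑' b : u, l * ν (Bs b.1.1 b.1.2) := ENNReal.tsum_mul_left.symm
    _ ≤ ∑' b : u, ∫⁻ y in B b.1.1 b.1.2, G y ∂μ := ENNReal.tsum_le_tsum fun b => ht b.1 (hut b.2)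
    _ = ∫⁻ y in ⋃ b ∈ u, B b.1 b.2, G y ∂μ :=
        (lintegral_biUnion huc (fun b _ => hBm b.1 b.2) hud G).symm
    _ ≤ _ := setLIntegral_le_lintegral _ _

lemma marcin {X : Type*} [MeasurableSpace X] (μ ν : Measure X) [SFinite μ] [SFinite ν]
    (F g : X → ℝ≥0∞) (hF : Measurable F) (hg : Measurable g) (C : ℝ≥0∞) (q : ℝ) (hq : 1 < q)
    (h : ∀ l : ℝ, 0 < l → ENNReal.ofReal l * ν {x | ENNReal.ofReal l < F x} ≤
      C * ∫⁻ x in {x | ENNReal.ofReal l < 2 * g x}, g x ∂μ) :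
    ∫⁻ x, F x ^ q ∂ν ≤ ENNReal.ofReal (q * 2 ^ (q - 1) / (q - 1)) * C * ∫⁻ x, g x ^ q ∂μ := by
  have hq0 : 0 < q := by linarith
  have hq1 : 0 < q - 1 := by linarith
  have e1 : ∀ a : ℝ≥0∞, a ^ q = ENNReal.ofReal q * ∫⁻ x in Ioi (0:ℝ),
      (if ENNReal.ofReal x < a then ENNReal.ofReal (x ^ (q - 1)) else 0) := by
    intro a
    rw [sc_cake q hq0, ← mul_assoc, ← ENNReal.ofReal_mul hq0.le, mul_one_div_cancel hq0.ne']
    simp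
  have mF : Measurable (Function.uncurry fun (x : X) (l : ℝ) =>
      if ENNReal.ofReal l < F x then ENNReal.ofReal (l ^ (q - 1)) else 0) := by
    refine Measurable.ite ?_ ?_ measurable_const
    · exact measurableSet_lt (by fun_prop) (by fun_prop)
    · fun_prop
  have mg : Measurable (Function.uncurry fun (x : X) (l : ℝ) =>
      (if ENNReal.ofReal l < 2 * g x then ENNReal.ofReal (l ^ (q - 1 - 1)) else 0) * g x) := by
    refine Measurable.mul (Measurable.ite ?_ ?_ measurable_const) (by fun_prop)
    · exact measurableSet_lt (by fun_prop) (by fun_prop)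
    · fun_prop
  calc ∫⁻ x, F x ^ q ∂ν
      = ENNReal.ofReal q * ∫⁻ x, ∫⁻ l in Ioi (0:ℝ),
        (if ENNReal.ofReal l < F x then ENNReal.ofReal (l ^ (q - 1)) else 0) ∂volume ∂ν := by
        rw [← lintegral_const_mul' _ _ ENNReal.ofReal_ne_top]
        exact lintegral_congr fun x => e1 _
    _ = ENNReal.ofReal q * ∫⁻ l in Ioi (0:ℝ), ∫⁻ x,
        (if ENNReal.ofReal l < F x then ENNReal.ofReal (l ^ (q - 1)) else 0) ∂ν := by
        rw [lintegral_lintegral_swap mF.aemeasurable]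
    _ ≤ ENNReal.ofReal q * ∫⁻ l in Ioi (0:ℝ), C * ∫⁻ x,
        (if ENNReal.ofReal l < 2 * g x then ENNReal.ofReal (l ^ (q - 1 - 1)) else 0) * g x ∂μ := by
        gcongr ENNReal.ofReal q * ?_
        refine setLIntegral_mono' measurableSet_Ioi fun l hl => ?_
        have hl0 : (0:ℝ) < l := hl
        have m1 : MeasurableSet {x | ENNReal.ofReal l < F x} := measurableSet_lt (by fun_prop) hF
        have m2 : MeasurableSet {x | ENNReal.ofReal l < 2 * g x} :=
          measurableSet_lt (by fun_prop) (by fun_prop)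
        have a1 : ∫⁻ x, (if ENNReal.ofReal l < F x then ENNReal.ofReal (l ^ (q - 1)) else 0) ∂ν
            = ENNReal.ofReal (l ^ (q - 1)) * ν {x | ENNReal.ofReal l < F x} := by
          rw [← lintegral_indicator_const m1]
          refine lintegral_congr fun x => ?_
          simp only [indicator, mem_ofPred_eq]
        have a2 : ∫⁻ x, (if ENNReal.ofReal l < 2 * g x then ENNReal.ofReal (l ^ (q - 1 - 1)) else 0)
            * g x ∂μ = ENNReal.ofReal (l ^ (q - 1 - 1)) *
              ∫⁻ x in {x | ENNReal.ofReal l < 2 * g x}, g x ∂μ := by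
          rw [← lintegral_indicator m2, ← lintegral_const_mul' _ _ ENNReal.ofReal_ne_top]
          refine lintegral_congr fun x => ?_
          simp only [indicator, mem_ofPred_eq]
          split_ifs <;> simp
        rw [a1, a2, show l ^ (q - 1) = l ^ (q - 1 - 1) * l by
          rw [← Real.rpow_add_one hl0.ne']; congr 1; ring,
          ENNReal.ofReal_mul (by positivity), mul_assoc, mul_left_comm C]
        exact mul_le_mul_right (h l hl0) _
    _ = ENNReal.ofReal q * (C * ∫⁻ x, ∫⁻ l in Ioi (0:ℝ),
        (if ENNReal.ofReal l < 2 * g x then ENNReal.ofReal (l ^ (q - 1 - 1)) else 0) * g x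
          ∂volume ∂μ) := by
        rw [lintegral_lintegral_swap mg.aemeasurable, lintegral_const_mul]
        exact Measurable.lintegral_prod_right' (f := fun p : ℝ × X =>
          (if ENNReal.ofReal p.1 < 2 * g p.2 then ENNReal.ofReal (p.1 ^ (q - 1 - 1)) else 0)
            * g p.2) (mg.comp measurable_swap)
    _ = ENNReal.ofReal q * (C * ∫⁻ x, ENNReal.ofReal (2 ^ (q - 1) / (q - 1)) * g x ^ q ∂μ) := by
        congr 2
        refine lintegral_congr fun x => ?_
        rw [lintegral_mul_const, sc_cake (q - 1) hq1, ENNReal.mul_rpow_of_nonneg _ _ hq1.le]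
        · rw [show (2:ℝ) ^ (q - 1) / (q - 1) = 2 ^ (q - 1) * (1 / (q - 1)) by ring,
            ENNReal.ofReal_mul (by positivity),
            ← ENNReal.ofReal_rpow_of_pos (x := (2:ℝ)) (by norm_num)]
          have : g x ^ q = g x ^ (q - 1) * g x := by
            conv_rhs => rw [← ENNReal.rpow_one (g x), ← ENNReal.rpow_mul, one_mul]
            rw [← ENNReal.rpow_add_of_nonneg _ _ hq1.le zero_le_one]; congr 1; ring
          rw [this]; simp only [ENNReal.ofReal_ofNat]; ring
        · refine Measurable.ite ?_ (by fun_prop) measurable_const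
          exact measurableSet_lt (by fun_prop) (by fun_prop)
    _ = _ := by
        rw [lintegral_const_mul' _ _ ENNReal.ofReal_ne_top,
          show q * 2 ^ (q - 1) / (q - 1) = q * (2 ^ (q - 1) / (q - 1)) by ring,
          ENNReal.ofReal_mul hq0.le]
        ring

/-! ### Abstract maximal theorem -/

lemma abs_max {X : Type*} [TopologicalSpace X] [TopologicalSpace.SeparableSpace X]
    [MeasurableSpace X] (μ ν : Measure X) [SFinite μ] [SFinite ν] (B Bs : ℤ → X → Set X)
    (hBm : ∀ k x, MeasurableSet (B k x)) (hBi : ∀ k x, (interior (B k x)).Nonempty)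
    (hself : ∀ k x, x ∈ B k x)
    (hBs : ∀ k x k' x', k ≤ k' → (B k x ∩ B k' x').Nonempty → B k x ⊆ Bs k' x')
    (c : ℤ → ℝ≥0∞) (hc : ∀ k x, c k * μ (B k x) ≤ 1) (W : X → ℝ≥0∞) (hW : Measurable W)
    (C : ℝ≥0∞) (hCW : ∀ k x, ∀ y ∈ B k x, c k * ν (Bs k x) ≤ C * W y)
    (g F : X → ℝ≥0∞) (hg : Measurable g) (hFm : Measurable F)
    (hF : ∀ x, F x = ⨆ k : ℤ, c k * ∫⁻ y in B k x, g y ∂μ) (q : ℝ) (hq : 1 < q) :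
    ∫⁻ x, F x ^ q ∂ν ≤
      ENNReal.ofReal (q * 2 ^ (q - 1) / (q - 1)) * (2 * C) * ∫⁻ x, W x * g x ^ q ∂μ := by
  have hgq : Measurable fun x => g x ^ q := by fun_prop
  have e0 := lintegral_withDensity_eq_lintegral_mul μ hW hgq
  simp only [Pi.mul_apply] at e0
  rw [← e0]
  refine marcin (μ.withDensity W) ν F g hFm hg (2 * C) q hq fun l hl => ?_
  set S : Set X := {x | ENNReal.ofReal l < 2 * g x} with hS
  have mS : MeasurableSet S := measurableSet_lt (by fun_prop) (by fun_prop)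
  set L : ℝ≥0∞ := ENNReal.ofReal (l / 2) with hL
  have hLL : ENNReal.ofReal l = L + L := by
    rw [hL, ← ENNReal.ofReal_add (by positivity) (by positivity)]; congr 1; ring
  have hLtop : L ≠ ∞ := ENNReal.ofReal_ne_top
  rw [setLIntegral_withDensity_eq_setLIntegral_mul μ hW hg mS]
  set g1 := S.indicator g with hg1
  have hgle : ∀ x, g x ≤ g1 x + L := by
    intro x
    by_cases hx : x ∈ S
    · simp [hg1, hx]
    · have h2 : 2 * g x ≤ 2 * L := by
        have : ¬ (ENNReal.ofReal l < 2 * g x) := hx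
        rw [not_lt, hLL, ← two_mul] at this
        exact this
      have : g x ≤ L := (ENNReal.mul_le_mul_iff_right (by norm_num) (by norm_num)).1 h2
      exact this.trans le_add_self
  let t : ℕ → Set (ℤ × X) := fun n =>
    {a | a.1 ≤ n ∧ L ≤ c a.1 * ∫⁻ y in B a.1 a.2, g1 y ∂μ}
  have hweak : ∀ n, L * ν (⋃ a ∈ t n, B a.1 a.2) ≤ ∫⁻ y, C * (W y * g1 y) ∂μ := by
    intro n
    refine vitali_weak μ ν B Bs hBm hBi hBs L _ (t n) n (fun a ha => ha.1) fun a ha => ?_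
    calc L * ν (Bs a.1 a.2) ≤ (c a.1 * ∫⁻ y in B a.1 a.2, g1 y ∂μ) * ν (Bs a.1 a.2) :=
          mul_le_mul_left ha.2 _
      _ = (c a.1 * ν (Bs a.1 a.2)) * ∫⁻ y in B a.1 a.2, g1 y ∂μ := by ring
      _ = ∫⁻ y in B a.1 a.2, (c a.1 * ν (Bs a.1 a.2)) * g1 y ∂μ := by
          rw [lintegral_const_mul _ (hg.indicator mS)]
      _ ≤ _ := by
          refine setLIntegral_mono' (hBm _ _) fun y hy => ?_
          rw [← mul_assoc]
          exact mul_le_mul_left (hCW _ _ y hy) _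
  have hcov : {x | ENNReal.ofReal l < F x} ⊆ ⋃ n, ⋃ a ∈ t n, B a.1 a.2 := by
    intro x hx
    have hx' : ENNReal.ofReal l < F x := hx
    rw [hF, lt_iSup_iff] at hx'
    obtain ⟨k, hk⟩ := hx'
    have h1 : c k * ∫⁻ y in B k x, g y ∂μ ≤ c k * ∫⁻ y in B k x, g1 y ∂μ + L := by
      calc c k * ∫⁻ y in B k x, g y ∂μ ≤ c k * ∫⁻ y in B k x, (g1 y + L) ∂μ := by
            gcongr with y; exact hgle y
        _ = c k * ∫⁻ y in B k x, g1 y ∂μ + (c k * μ (B k x)) * L := by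
            rw [lintegral_add_right _ measurable_const, setLIntegral_const]; ring
        _ ≤ _ := by
            gcongr
            exact (mul_le_mul_left (hc k x) L).trans (by simp)
    have h2 : L ≤ c k * ∫⁻ y in B k x, g1 y ∂μ := by
      have := hk.le.trans h1
      rw [hLL] at this
      exact (ENNReal.add_le_add_iff_right hLtop).1 this
    refine mem_iUnion.2 ⟨k.toNat, mem_iUnion₂.2 ⟨(k, x), ⟨?_, h2⟩, hself k x⟩⟩
    exact Int.self_le_toNat k
  have hmono : Monotone fun n => ⋃ a ∈ t n, B a.1 a.2 := by
    intro m n hmn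
    refine biUnion_subset_biUnion_left fun a ha => ⟨ha.1.trans ?_, ha.2⟩
    exact_mod_cast hmn
  have hfin : L * ν {x | ENNReal.ofReal l < F x} ≤ ∫⁻ y, C * (W y * g1 y) ∂μ := by
    calc L * ν {x | ENNReal.ofReal l < F x} ≤ L * ν (⋃ n, ⋃ a ∈ t n, B a.1 a.2) := by
          gcongr
      _ = ⨆ n, L * ν (⋃ a ∈ t n, B a.1 a.2) := by
          rw [hmono.measure_iUnion, ENNReal.mul_iSup]
      _ ≤ _ := iSup_le hweak
  rw [show ENNReal.ofReal l * ν {x | ENNReal.ofReal l < F x}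
    = 2 * (L * ν {x | ENNReal.ofReal l < F x}) by rw [← mul_assoc, two_mul, ← hLL], mul_assoc]
  refine mul_le_mul_right (hfin.trans_eq ?_) _
  have mm : Measurable fun y => W y * g1 y := hW.mul (hg.indicator mS)
  rw [lintegral_const_mul _ mm, ← lintegral_indicator mS]
  congr 1
  refine lintegral_congr fun y => ?_
  by_cases hy : y ∈ S <;> simp [hg1, hy]

/-! ### Geometry of cylinders -/

lemma pCyl_eq (d : ℕ) (r : ℝ) (z : Pt d) :
    pCyl d r z = Ico z.1 (z.1 + r ^ 2) ×ˢ Metric.ball z.2 r := by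
  ext w
  simp only [pCyl, mem_prod, mem_Ico, Metric.mem_ball, dist_comm z.2]
  constructor
  · rintro ⟨h1, h2, h3⟩; exact ⟨⟨h2, h3⟩, h1⟩
  · rintro ⟨⟨h2, h3⟩, h1⟩; exact ⟨h1, h2, h3⟩

lemma mem_pCyl {d : ℕ} {r : ℝ} {z w : Pt d} :
    w ∈ pCyl d r z ↔ dist z.2 w.2 < r ∧ z.1 ≤ w.1 ∧ w.1 < z.1 + r ^ 2 := Iff.rfl

lemma pCyl_meas (d : ℕ) (r : ℝ) (z : Pt d) : MeasurableSet (pCyl d r z) := by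
  rw [pCyl_eq]; exact measurableSet_Ico.prod measurableSet_ball

def V0 (d : ℕ) : ℝ≥0∞ := volume (Metric.ball (0 : Ed d) 1)

lemma V0_pos (d : ℕ) : V0 d ≠ 0 := (Metric.measure_ball_pos volume (0 : Ed d) one_pos).ne'
lemma V0_top (d : ℕ) : V0 d ≠ ∞ := measure_ball_lt_top.ne

lemma vol_ball (d : ℕ) (hd : 1 ≤ d) (x : Ed d) (r : ℝ) (hr : 0 ≤ r) :
    volume (Metric.ball x r) = ENNReal.ofReal (r ^ d) * V0 d := by
  have : Nonempty (Fin d) := ⟨⟨0, hd⟩⟩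
  rw [Measure.addHaar_ball _ _ hr, finrank_euclideanSpace_fin, V0]

lemma vol_pCyl (d : ℕ) (hd : 1 ≤ d) (z : Pt d) (r : ℝ) (hr : 0 ≤ r) :
    volume (pCyl d r z) = ENNReal.ofReal (r ^ (d + 2)) * V0 d := by
  rw [pCyl_eq, Measure.volume_eq_prod, Measure.prod_prod, Real.volume_Ico, vol_ball d hd _ _ hr,
    ← mul_assoc, ← ENNReal.ofReal_mul (by ring_nf; positivity)]
  congr 2; ring

lemma cylInt_meas (d : ℕ) (f : Pt d → ℝ≥0∞) (hf : Measurable f) :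
    Measurable fun p : ℝ × Pt d => ∫⁻ w in pCyl d p.1 p.2, f w := by
  have hS : MeasurableSet {p : (ℝ × Pt d) × Pt d | p.2 ∈ pCyl d p.1.1 p.1.2} := by
    have h1 : MeasurableSet {p : (ℝ × Pt d) × Pt d | dist p.1.2.2 p.2.2 < p.1.1} :=
      measurableSet_lt (by fun_prop) (by fun_prop)
    have h2 : MeasurableSet {p : (ℝ × Pt d) × Pt d | p.1.2.1 ≤ p.2.1} :=
      measurableSet_le (by fun_prop) (by fun_prop)
    have h3 : MeasurableSet {p : (ℝ × Pt d) × Pt d | p.2.1 < p.1.2.1 + p.1.1 ^ 2} :=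
      measurableSet_lt (by fun_prop) (by fun_prop)
    exact h1.inter (h2.inter h3)
  have : (fun p : ℝ × Pt d => ∫⁻ w in pCyl d p.1 p.2, f w) = fun p => ∫⁻ w,
      ({p : (ℝ × Pt d) × Pt d | p.2 ∈ pCyl d p.1.1 p.1.2}.indicator fun p => f p.2) (p, w) := by
    funext p
    rw [← lintegral_indicator (pCyl_meas d _ _)]
    rfl
  rw [this]
  exact Measurable.lintegral_prod_right' ((hf.comp measurable_snd).indicator hS)

lemma pAvg_meas (d : ℕ) (hd : 1 ≤ d) (r : ℝ) (hr : 0 ≤ r) (f : Pt d → ℝ≥0∞) (hf : Measurable f) :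
    Measurable fun z => pAvg d r z f := by
  unfold pAvg
  simp only [vol_pCyl d hd _ r hr]
  exact ((cylInt_meas d f hf).comp (measurable_const.prodMk measurable_id)).const_mul _

/-- Dyadic forward parabolic maximal function. -/
def pM (d : ℕ) (f : Pt d → ℝ≥0∞) (z : Pt d) : ℝ≥0∞ := ⨆ k : ℤ, pAvg d (2 ^ k) z f

lemma pM_meas (d : ℕ) (hd : 1 ≤ d) (f : Pt d → ℝ≥0∞) (hf : Measurable f) :
    Measurable (pM d f) :=
  Measurable.iSup fun k => pAvg_meas d hd _ (by positivity) f hf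

/-- Time maximal function. -/
def tM (g : ℝ → ℝ≥0∞) (t : ℝ) : ℝ≥0∞ :=
  ⨆ k : ℤ, (ENNReal.ofReal (4 * ((2:ℝ) ^ k) ^ 2))⁻¹ *
    ∫⁻ s in Ioo (t - 2 * ((2:ℝ) ^ k) ^ 2) (t + 2 * ((2:ℝ) ^ k) ^ 2), g s

lemma tM_meas (g : ℝ → ℝ≥0∞) (hg : Measurable g) : Measurable (tM g) := by
  refine Measurable.iSup fun k => Measurable.const_mul ?_ _
  set R := 2 * ((2:ℝ) ^ k) ^ 2
  have hS : MeasurableSet {p : ℝ × ℝ | p.2 ∈ Ioo (p.1 - R) (p.1 + R)} := by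
    have h1 : MeasurableSet {p : ℝ × ℝ | p.1 - R < p.2} :=
      measurableSet_lt (by fun_prop) (by fun_prop)
    have h2 : MeasurableSet {p : ℝ × ℝ | p.2 < p.1 + R} :=
      measurableSet_lt (by fun_prop) (by fun_prop)
    exact h1.inter h2
  have : (fun t : ℝ => ∫⁻ s in Ioo (t - R) (t + R), g s) = fun t => ∫⁻ s,
      ({p : ℝ × ℝ | p.2 ∈ Ioo (p.1 - R) (p.1 + R)}.indicator fun p => g p.2) (t, s) := by
    funext t
    rw [← lintegral_indicator measurableSet_Ioo]
    rfl
  rw [this]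
  exact Measurable.lintegral_prod_right' ((hg.comp measurable_snd).indicator hS)

lemma tM_bound (g : ℝ → ℝ≥0∞) (t : ℝ) (k : ℤ) (S : Set ℝ)
    (hS : S ⊆ Ioo (t - 2 * ((2:ℝ) ^ k) ^ 2) (t + 2 * ((2:ℝ) ^ k) ^ 2)) :
    (ENNReal.ofReal (((2:ℝ) ^ k) ^ 2))⁻¹ * ∫⁻ s in S, g s ≤ 4 * tM g t := by
  have h1 := le_iSup (fun k : ℤ => (ENNReal.ofReal (4 * ((2:ℝ) ^ k) ^ 2))⁻¹ *
    ∫⁻ s in Ioo (t - 2 * ((2:ℝ) ^ k) ^ 2) (t + 2 * ((2:ℝ) ^ k) ^ 2), g s) k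
  calc _ ≤ (ENNReal.ofReal (((2:ℝ) ^ k) ^ 2))⁻¹ *
      ∫⁻ s in Ioo (t - 2 * ((2:ℝ) ^ k) ^ 2) (t + 2 * ((2:ℝ) ^ k) ^ 2), g s := by gcongr
    _ = 4 * ((ENNReal.ofReal (4 * ((2:ℝ) ^ k) ^ 2))⁻¹ *
      ∫⁻ s in Ioo (t - 2 * ((2:ℝ) ^ k) ^ 2) (t + 2 * ((2:ℝ) ^ k) ^ 2), g s) := by
        rw [ENNReal.ofReal_mul (by norm_num), ENNReal.mul_inv (by simp) (by simp), ← mul_assoc,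
          ← mul_assoc]
        simp only [ENNReal.ofReal_ofNat]
        rw [ENNReal.mul_inv_cancel (by norm_num) (by norm_num), one_mul]
    _ ≤ _ := by gcongr; exact h1

lemma tM_strong (q : ℝ) (hq : 1 < q) (g : ℝ → ℝ≥0∞) (hg : Measurable g) :
    ∫⁻ t, tM g t ^ q ≤ ENNReal.ofReal (q * 2 ^ (q - 1) / (q - 1)) * (2 * 3) * ∫⁻ t, g t ^ q := by
  have := abs_max (volume : Measure ℝ) volume
    (fun k t => Ioo (t - 2 * ((2:ℝ) ^ k) ^ 2) (t + 2 * ((2:ℝ) ^ k) ^ 2))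
    (fun k t => Ioo (t - 6 * ((2:ℝ) ^ k) ^ 2) (t + 6 * ((2:ℝ) ^ k) ^ 2))
    (fun k x => measurableSet_Ioo) (fun k x => ?_) (fun k x => ?_) ?_
    (fun k => (ENNReal.ofReal (4 * ((2:ℝ) ^ k) ^ 2))⁻¹) (fun k x => ?_) (fun _ => 1)
    measurable_const 3 (fun k x y _ => ?_) g (tM g) hg (tM_meas g hg) (fun x => rfl) q hq
  · simpa using this
  · have : (0:ℝ) < ((2:ℝ) ^ k) ^ 2 := by positivity
    rw [interior_Ioo]; exact nonempty_Ioo.2 (by linarith)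
  · have : (0:ℝ) < ((2:ℝ) ^ k) ^ 2 := by positivity
    constructor <;> linarith
  · rintro k x k' x' hk ⟨y, hy, hy'⟩ w hw
    have h1 : ((2:ℝ) ^ k) ^ 2 ≤ ((2:ℝ) ^ k') ^ 2 := by
      have : (2:ℝ) ^ k ≤ (2:ℝ) ^ k' := zpow_le_zpow_right₀ (by norm_num) hk
      gcongr
    simp only [mem_Ioo] at *
    constructor <;> linarith [hy.1, hy.2, hy'.1, hy'.2, hw.1, hw.2]
  · have : (0:ℝ) < ((2:ℝ) ^ k) ^ 2 := by positivity
    rw [Real.volume_Ioo, show x + 2 * ((2:ℝ) ^ k) ^ 2 - (x - 2 * ((2:ℝ) ^ k) ^ 2)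
      = 4 * ((2:ℝ) ^ k) ^ 2 by ring]
    exact ENNReal.inv_mul_le_one _
  · have : (0:ℝ) < ((2:ℝ) ^ k) ^ 2 := by positivity
    rw [Real.volume_Ioo, show x + 6 * ((2:ℝ) ^ k) ^ 2 - (x - 6 * ((2:ℝ) ^ k) ^ 2)
      = 3 * (4 * ((2:ℝ) ^ k) ^ 2) by ring,
      ENNReal.ofReal_mul (p := 3) (by norm_num), mul_left_comm, ENNReal.ofReal_ofNat 3]
    exact mul_le_mul_right (ENNReal.inv_mul_le_one _) _

lemma pM_weighted (d : ℕ) (hd : 1 ≤ d) (q : ℝ) (hq : 1 < q) (f : Pt d → ℝ≥0∞) (hf : Measurable f)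
    (w W : ℝ → ℝ≥0∞) (hw : Measurable w) (hWm : Measurable W)
    (hW : ∀ (k : ℤ) (t : ℝ), ∀ s ∈ Ico t (t + ((2:ℝ) ^ k) ^ 2),
      (ENNReal.ofReal (((2:ℝ) ^ k) ^ 2))⁻¹ *
        ∫⁻ s in Ico (t - ((2:ℝ) ^ k) ^ 2) (t + 2 * ((2:ℝ) ^ k) ^ 2), w s ≤ 4 * W s) :
    ∫⁻ z : Pt d, w z.1 * pM d f z ^ q ≤
      ENNReal.ofReal (q * 2 ^ (q - 1) / (q - 1)) * (2 * (4 * 3 ^ d)) *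
        ∫⁻ z : Pt d, W z.1 * f z ^ q := by
  have hw1 : Measurable fun z : Pt d => w z.1 := hw.comp measurable_fst
  have := abs_max (volume : Measure (Pt d)) (volume.withDensity fun z : Pt d => w z.1)
    (fun k z => pCyl d (2 ^ k) z)
    (fun k z => Ico (z.1 - ((2:ℝ) ^ k) ^ 2) (z.1 + 2 * ((2:ℝ) ^ k) ^ 2) ×ˢ
      Metric.ball z.2 (3 * 2 ^ k))
    (fun k z => pCyl_meas d _ z) (fun k z => ?_) (fun k z => ?_) ?_
    (fun k => (volume (pCyl d (2 ^ k) (0 : Pt d)))⁻¹) (fun k z => ?_) (fun z => W z.1)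
    (hWm.comp measurable_fst) (4 * 3 ^ d) (fun k z y hy => ?_) f (pM d f) hf (pM_meas d hd f hf)
    (fun z => ?_) q hq
  · rw [lintegral_withDensity_eq_lintegral_mul _ hw1 ((pM_meas d hd f hf).pow_const q)] at this
    simpa using this
  · have h0 : (0:ℝ) < (2:ℝ) ^ k := by positivity
    rw [pCyl_eq, interior_prod_eq, interior_Ico, Metric.isOpen_ball.interior_eq]
    refine (nonempty_Ioo.2 ?_).prod (Metric.nonempty_ball.2 h0)
    have : (0:ℝ) < ((2:ℝ) ^ k) ^ 2 := by positivity
    linarith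
  · have : (0:ℝ) < ((2:ℝ) ^ k) ^ 2 := by positivity
    rw [mem_pCyl]
    exact ⟨by simp; positivity, le_rfl, by linarith⟩
  · rintro k z k' z' hk ⟨y, hy, hy'⟩ v hv
    have h0 : (2:ℝ) ^ k ≤ (2:ℝ) ^ k' := zpow_le_zpow_right₀ (by norm_num) hk
    have h1 : ((2:ℝ) ^ k) ^ 2 ≤ ((2:ℝ) ^ k') ^ 2 := by gcongr
    rw [mem_pCyl] at hy hy' hv
    refine ⟨⟨?_, ?_⟩, ?_⟩
    · linarith [hy.2.1, hy.2.2, hy'.2.1, hy'.2.2, hv.2.1, hv.2.2]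
    · linarith [hy.2.1, hy.2.2, hy'.2.1, hy'.2.2, hv.2.1, hv.2.2]
    · rw [Metric.mem_ball]
      have t1 := dist_triangle v.2 z.2 z'.2
      have t2 := dist_triangle z.2 y.2 z'.2
      rw [dist_comm v.2 z.2] at t1
      rw [dist_comm y.2 z'.2] at t2
      linarith [hy.1, hy'.1, hv.1]
  · have h0 : (0:ℝ) ≤ (2:ℝ) ^ k := by positivity
    rw [vol_pCyl d hd _ _ h0, vol_pCyl d hd _ _ h0]
    exact ENNReal.inv_mul_le_one _
  · have h0 : (0:ℝ) < (2:ℝ) ^ k := by positivity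
    rw [pCyl_eq] at hy
    have h1 := hW k z.1 y.1 hy.1
    rw [withDensity_apply _ (measurableSet_Ico.prod measurableSet_ball), Measure.volume_eq_prod,
      setLIntegral_prod (fun a : Pt d => w a.1) hw1.aemeasurable]
    simp only [setLIntegral_const]
    rw [lintegral_mul_const _ hw, vol_ball d hd _ _ (by positivity), ← Measure.volume_eq_prod,
      vol_pCyl d hd _ _ h0.le]
    rw [mul_pow, pow_add, ENNReal.ofReal_mul (by positivity), ENNReal.ofReal_mul (by positivity)]
    set A := ENNReal.ofReal (((2:ℝ) ^ k) ^ d)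
    set A2 := ENNReal.ofReal (((2:ℝ) ^ k) ^ 2)
    have hA : A ≠ 0 := by simp only [A, ne_eq, ENNReal.ofReal_eq_zero, not_le]; positivity
    have hA2 : A2 ≠ 0 := by simp only [A2, ne_eq, ENNReal.ofReal_eq_zero, not_le]; positivity
    have hAt : A ≠ ∞ := ENNReal.ofReal_ne_top
    have hA2t : A2 ≠ ∞ := ENNReal.ofReal_ne_top
    have h3 : ENNReal.ofReal (3 ^ d) = 3 ^ d := by
      rw [ENNReal.ofReal_pow (by norm_num)]; simp
    rw [h3, ENNReal.mul_inv (Or.inr (V0_top d)) (Or.inr (V0_pos d)),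
      ENNReal.mul_inv (Or.inl hA) (Or.inl hAt)]
    set I := ∫⁻ s in Ico (z.1 - ((2:ℝ) ^ k) ^ 2) (z.1 + 2 * ((2:ℝ) ^ k) ^ 2), w s
    calc A⁻¹ * A2⁻¹ * (V0 d)⁻¹ * (I * (3 ^ d * A * V0 d))
        = (A⁻¹ * A) * ((V0 d)⁻¹ * V0 d) * (3 ^ d * (A2⁻¹ * I)) := by ring
      _ = 3 ^ d * (A2⁻¹ * I) := by
          rw [ENNReal.inv_mul_cancel hA hAt, ENNReal.inv_mul_cancel (V0_pos d) (V0_top d)]; simp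
      _ ≤ 3 ^ d * (4 * W y.1) := by gcongr
      _ = _ := by ring
  · unfold pM pAvg
    refine iSup_congr fun k => ?_
    have h0 : (0:ℝ) ≤ (2:ℝ) ^ k := by positivity
    rw [vol_pCyl d hd _ _ h0, vol_pCyl d hd _ _ h0]

lemma pM_unweighted (d : ℕ) (hd : 1 ≤ d) (q : ℝ) (hq : 1 < q) (f : Pt d → ℝ≥0∞)
    (hf : Measurable f) :
    ∫⁻ z : Pt d, pM d f z ^ q ≤
      ENNReal.ofReal (q * 2 ^ (q - 1) / (q - 1)) * (2 * (4 * 3 ^ d)) * ∫⁻ z : Pt d, f z ^ q := by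
  have := pM_weighted d hd q hq f hf (fun _ => 1) (fun _ => 1) measurable_const measurable_const ?_
  · simpa using this
  · intro k t s _
    rw [setLIntegral_const, one_mul, mul_one, Real.volume_Ico,
      show t + 2 * ((2:ℝ) ^ k) ^ 2 - (t - ((2:ℝ) ^ k) ^ 2) = 3 * ((2:ℝ) ^ k) ^ 2 by ring,
      ENNReal.ofReal_mul (by norm_num), mul_left_comm]
    refine (mul_le_mul_right (ENNReal.inv_mul_le_one _) _).trans ?_
    simp only [ENNReal.ofReal_ofNat, mul_one]
    norm_num

lemma pM_fs (d : ℕ) (hd : 1 ≤ d) (q : ℝ) (hq : 1 < q) (f : Pt d → ℝ≥0∞)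
    (hf : Measurable f) (w : ℝ → ℝ≥0∞) (hw : Measurable w) :
    ∫⁻ z : Pt d, w z.1 * pM d f z ^ q ≤
      ENNReal.ofReal (q * 2 ^ (q - 1) / (q - 1)) * (2 * (4 * 3 ^ d)) *
        ∫⁻ z : Pt d, tM w z.1 * f z ^ q := by
  refine pM_weighted d hd q hq f hf w (tM w) hw (tM_meas w hw) fun k t s hs => ?_
  refine tM_bound w s k _ fun v hv => ?_
  have : (0:ℝ) < ((2:ℝ) ^ k) ^ 2 := by positivity
  constructor <;> linarith [hs.1, hs.2, hv.1, hv.2]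

/-! ### Mixed norm maximal theorem -/

lemma slice_meas (d : ℕ) (q : ℝ) (f : Pt d → ℝ≥0∞) (hf : Measurable f) :
    Measurable fun t : ℝ => ∫⁻ x : Ed d, f (t, x) ^ q :=
  Measurable.lintegral_prod_right' (f := fun p : ℝ × Ed d => f p ^ q) (hf.pow_const q)

lemma pAvg_time (d : ℕ) (hd : 1 ≤ d) (G : ℝ → ℝ≥0∞) (hG : Measurable G) (k : ℤ) (z : Pt d) :
    pAvg d (2 ^ k) z (fun w => G w.1) ≤ 4 * tM G z.1 := by
  have h0 : (0:ℝ) < (2:ℝ) ^ k := by positivity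
  have h2 : (0:ℝ) < ((2:ℝ) ^ k) ^ 2 := by positivity
  have h1 := tM_bound G z.1 k (Ico z.1 (z.1 + ((2:ℝ) ^ k) ^ 2)) (fun v hv => by
    constructor <;> linarith [hv.1, hv.2])
  refine le_trans (le_of_eq ?_) h1
  have hG1 : Measurable fun z : Pt d => G z.1 := hG.comp measurable_fst
  unfold pAvg
  rw [vol_pCyl d hd _ _ h0.le, pCyl_eq, Measure.volume_eq_prod,
    setLIntegral_prod (fun a : Pt d => G a.1) hG1.aemeasurable]
  simp only [setLIntegral_const]
  rw [lintegral_mul_const _ hG, vol_ball d hd _ _ (by positivity)]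
  rw [pow_add, ENNReal.ofReal_mul (by positivity)]
  set A := ENNReal.ofReal (((2:ℝ) ^ k) ^ d)
  set A2 := ENNReal.ofReal (((2:ℝ) ^ k) ^ 2)
  have hA : A ≠ 0 := by simp only [A, ne_eq, ENNReal.ofReal_eq_zero, not_le]; positivity
  have hAt : A ≠ ∞ := ENNReal.ofReal_ne_top
  rw [ENNReal.mul_inv (Or.inr (V0_top d)) (Or.inr (V0_pos d)),
      ENNReal.mul_inv (Or.inl hA) (Or.inl hAt)]
  set I := ∫⁻ s in Ico z.1 (z.1 + ((2:ℝ) ^ k) ^ 2), G s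
  calc A⁻¹ * A2⁻¹ * (V0 d)⁻¹ * (I * (A * V0 d))
        = (A⁻¹ * A) * ((V0 d)⁻¹ * V0 d) * (A2⁻¹ * I) := by ring
      _ = (A2⁻¹ * I) := by
          rw [ENNReal.inv_mul_cancel hA hAt, ENNReal.inv_mul_cancel (V0_pos d) (V0_top d)]; simp

lemma mixed_max_A (d : ℕ) (hd : 1 ≤ d) (q₁ q₂ : ℝ) (hq₁ : 1 < q₁) (hq₂ : 1 < q₂) (h12 : q₂ ≤ q₁) :
    ∃ C : ℝ≥0∞, C ≠ ∞ ∧ ∀ f : Pt d → ℝ≥0∞, Measurable f →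
      ∫⁻ t : ℝ, (∫⁻ x : Ed d, pM d f (t, x) ^ q₁) ^ (q₂ / q₁) ≤
        C * ∫⁻ t : ℝ, (∫⁻ x : Ed d, f (t, x) ^ q₁) ^ (q₂ / q₁) := by
  have p1 : 0 < q₁ := by linarith
  have p2 : 0 < q₂ := by linarith
  set θ := q₂ / q₁ with hθ
  have hθ0 : 0 < θ := by positivity
  have hθ1 : θ ≤ 1 := (div_le_one p1).2 h12
  have hθ1' : 0 ≤ 1 - θ := by linarith
  have hqθ : q₁ * θ = q₂ := by rw [hθ]; field_simp
  obtain ⟨C1, hC1, hC1t⟩ : ∃ C1 : ℝ≥0∞, C1 ≠ ∞ ∧ ∀ f : Pt d → ℝ≥0∞, Measurable f →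
      ∫⁻ z : Pt d, pM d f z ^ q₂ ≤ C1 * ∫⁻ z : Pt d, f z ^ q₂ :=
    ⟨_, by finiteness, fun f hf => pM_unweighted d hd q₂ hq₂ f hf⟩
  obtain ⟨C2, hC2, hC2t⟩ : ∃ C1 : ℝ≥0∞, C1 ≠ ∞ ∧ ∀ g : ℝ → ℝ≥0∞, Measurable g →
      ∫⁻ z, tM g z ^ q₂ ≤ C1 * ∫⁻ z, g z ^ q₂ :=
    ⟨_, by finiteness, fun g hg => tM_strong q₂ hq₂ g hg⟩
  refine ⟨C1 ^ θ * (4 ^ q₂ * C2) ^ (1 - θ) + 1, ?_, fun f hf => ?_⟩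
  · finiteness
  set G : ℝ → ℝ≥0∞ := fun t => (∫⁻ x : Ed d, f (t, x) ^ q₁) ^ (1 / q₁) with hGdef
  have hGm : Measurable G := (slice_meas d q₁ f hf).pow_const _
  have hG1 : Measurable fun z : Pt d => G z.1 := hGm.comp measurable_fst
  have hGq1 : ∀ t, G t ^ q₁ = ∫⁻ x : Ed d, f (t, x) ^ q₁ := fun t => by
    rw [hGdef]; simp only
    rw [← ENNReal.rpow_mul, one_div_mul_cancel p1.ne', ENNReal.rpow_one]
  have hGq2 : ∀ t, (∫⁻ x : Ed d, f (t, x) ^ q₁) ^ θ = G t ^ q₂ := fun t => by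
    rw [← hGq1, ← ENNReal.rpow_mul, hqθ]
  simp only [hGq2]
  set I := ∫⁻ t, G t ^ q₂ with hI
  by_cases hItop : I = ∞
  · rw [hItop, ENNReal.mul_top (by simp)]; exact le_top
  set φ : Pt d → ℝ≥0∞ := fun z => f z ^ (1 / θ) * G z.1 ^ (1 - 1 / θ) with hφ
  have hφm : Measurable φ := (hf.pow_const _).mul (hG1.pow_const _)
  have hae : ∀ᵐ z : Pt d, f z ≤ φ z ^ θ * G z.1 ^ (1 - θ) := by
    rw [Measure.volume_eq_prod, Measure.ae_prod_iff_ae_ae]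
    · have hfin : ∀ᵐ t : ℝ, G t ^ q₂ < ∞ := ae_lt_top (hGm.pow_const _) hItop
      filter_upwards [hfin] with t ht
      have hGt : G t ≠ ∞ := by
        intro h; rw [h, ENNReal.top_rpow_of_pos p2] at ht; exact lt_irrefl _ ht
      by_cases hG0 : G t = 0
      · have h0 : ∫⁻ x : Ed d, f (t, x) ^ q₁ = 0 := by
          rw [← hGq1, hG0, ENNReal.zero_rpow_of_pos p1]
        have ms : Measurable fun x : Ed d => f (t, x) ^ q₁ :=
          (hf.comp measurable_prodMk_left).pow_const _
        rw [lintegral_eq_zero_iff ms] at h0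
        filter_upwards [h0] with x hx
        have : f (t, x) = 0 := by
          simpa [p1, p1.not_gt] using hx
        rw [this]; exact zero_le
      · refine Eventually.of_forall fun x => le_of_eq ?_
        simp only [hφ]
        rw [ENNReal.mul_rpow_of_nonneg _ _ hθ0.le, ← ENNReal.rpow_mul, ← ENNReal.rpow_mul,
          one_div_mul_cancel hθ0.ne', ENNReal.rpow_one, mul_assoc,
          ← ENNReal.rpow_add _ _ hG0 hGt]
        have : (1 - 1 / θ) * θ + (1 - θ) = 0 := by field_simp; ring
        rw [this, ENNReal.rpow_zero, mul_one]
    · exact measurableSet_le hf ((hφm.pow_const _).mul (hG1.pow_const _))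
  have hpt : ∀ z : Pt d, pM d f z ≤ pM d φ z ^ θ * (4 * tM G z.1) ^ (1 - θ) := by
    intro z
    refine iSup_le fun k => ?_
    have a1 : pAvg d (2 ^ k) z f ≤ pAvg d (2 ^ k) z φ ^ θ *
        pAvg d (2 ^ k) z (fun w => G w.1) ^ (1 - θ) := by
      unfold pAvg
      set v := (volume (pCyl d (2 ^ k) z))⁻¹
      calc v * ∫⁻ w in pCyl d (2 ^ k) z, f w
          ≤ v * ∫⁻ w in pCyl d (2 ^ k) z, φ w ^ θ * G w.1 ^ (1 - θ) := by
            gcongr v * ?_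
            exact lintegral_mono_ae (ae_restrict_of_ae hae)
        _ ≤ v * ((∫⁻ w in pCyl d (2 ^ k) z, φ w) ^ θ *
              (∫⁻ w in pCyl d (2 ^ k) z, G w.1) ^ (1 - θ)) := by
            gcongr v * ?_
            exact ENNReal.lintegral_mul_norm_pow_le hφm.aemeasurable hG1.aemeasurable
              hθ0.le hθ1' (by ring)
        _ = v ^ θ * v ^ (1 - θ) * ((∫⁻ w in pCyl d (2 ^ k) z, φ w) ^ θ *
              (∫⁻ w in pCyl d (2 ^ k) z, G w.1) ^ (1 - θ)) := by
            rw [← ENNReal.rpow_add_of_nonneg _ _ hθ0.le hθ1']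
            simp
        _ = _ := by
            rw [ENNReal.mul_rpow_of_nonneg _ _ hθ0.le, ENNReal.mul_rpow_of_nonneg _ _ hθ1']
            ring
    refine a1.trans ?_
    gcongr
    · exact le_iSup (fun k : ℤ => pAvg d (2 ^ k) z φ) k
    · exact pAvg_time d hd G hGm k z
  have hφint : ∫⁻ z : Pt d, φ z ^ q₂ ≤ I := by
    rw [Measure.volume_eq_prod, lintegral_prod _ (hφm.pow_const _).aemeasurable]
    refine lintegral_mono fun t => ?_
    have e : ∀ x, φ (t, x) ^ q₂ = f (t, x) ^ q₁ * G t ^ (q₂ - q₁) := fun x => by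
      simp only [hφ]
      rw [ENNReal.mul_rpow_of_nonneg _ _ p2.le, ← ENNReal.rpow_mul, ← ENNReal.rpow_mul]
      have e1 : 1 / θ * q₂ = q₁ := by rw [hθ]; field_simp
      have e2 : (1 - 1 / θ) * q₂ = q₂ - q₁ := by rw [sub_mul, e1, one_mul]
      rw [e1, e2]
    simp only [e]
    have ms : Measurable fun x : Ed d => f (t, x) ^ q₁ :=
      (hf.comp measurable_prodMk_left).pow_const _
    rw [lintegral_mul_const _ ms, ← hGq1]
    by_cases hG0 : G t = 0
    · simp [hG0, p1]
    by_cases hGt : G t = ∞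
    · rw [hGt, ENNReal.top_rpow_of_pos p2]; exact le_top
    rw [← ENNReal.rpow_add _ _ hG0 hGt]
    rw [show q₁ + (q₂ - q₁) = q₂ by ring]
  have mP := slice_meas d q₂ (pM d φ) (pM_meas d hd φ hφm)
  have mT : Measurable fun t => (4 * tM G t) ^ q₂ := ((tM_meas G hGm).const_mul 4).pow_const _
  calc ∫⁻ t : ℝ, (∫⁻ x : Ed d, pM d f (t, x) ^ q₁) ^ θ
      ≤ ∫⁻ t : ℝ, (∫⁻ x : Ed d, pM d φ (t, x) ^ q₂) ^ θ * ((4 * tM G t) ^ q₂) ^ (1 - θ) := by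
        refine lintegral_mono fun t => ?_
        calc (∫⁻ x : Ed d, pM d f (t, x) ^ q₁) ^ θ
            ≤ (∫⁻ x : Ed d, pM d φ (t, x) ^ q₂ * ((4 * tM G t) ^ (1 - θ)) ^ q₁) ^ θ := by
              gcongr with x
              calc pM d f (t, x) ^ q₁ ≤ (pM d φ (t, x) ^ θ * (4 * tM G t) ^ (1 - θ)) ^ q₁ := by
                    gcongr; exact hpt (t, x)
                _ = _ := by
                    rw [ENNReal.mul_rpow_of_nonneg _ _ p1.le, ← ENNReal.rpow_mul, mul_comm θ, hqθ]
          _ = _ := by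
              have ms : Measurable fun x : Ed d => pM d φ (t, x) ^ q₂ :=
                ((pM_meas d hd φ hφm).comp measurable_prodMk_left).pow_const _
              rw [lintegral_mul_const _ ms,
                ENNReal.mul_rpow_of_nonneg _ _ hθ0.le, ← ENNReal.rpow_mul, ← ENNReal.rpow_mul,
                ← ENNReal.rpow_mul]
              congr 2
              rw [hqθ, mul_comm]
    _ ≤ (∫⁻ t : ℝ, ∫⁻ x : Ed d, pM d φ (t, x) ^ q₂) ^ θ *
          (∫⁻ t : ℝ, (4 * tM G t) ^ q₂) ^ (1 - θ) :=
        ENNReal.lintegral_mul_norm_pow_le mP.aemeasurable mT.aemeasurable hθ0.le hθ1' (by ring)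
    _ ≤ (C1 * I) ^ θ * (4 ^ q₂ * C2 * I) ^ (1 - θ) := by
        gcongr
        · rw [← lintegral_prod (fun z : Pt d => pM d φ z ^ q₂)
            ((pM_meas d hd φ hφm).pow_const _).aemeasurable, ← Measure.volume_eq_prod]
          exact (hC1t φ hφm).trans (by gcongr)
        · simp only [ENNReal.mul_rpow_of_nonneg _ _ p2.le]
          rw [lintegral_const_mul _ ((tM_meas G hGm).pow_const _), mul_assoc]
          gcongr
          exact hC2t G hGm
    _ = C1 ^ θ * (4 ^ q₂ * C2) ^ (1 - θ) * I := by
        rw [ENNReal.mul_rpow_of_nonneg _ _ hθ0.le, ENNReal.mul_rpow_of_nonneg _ _ hθ1']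
        have : I = I ^ θ * I ^ (1 - θ) := by
          rw [← ENNReal.rpow_add_of_nonneg _ _ hθ0.le hθ1']; simp
        conv_rhs => rw [this]
        ring
    _ ≤ _ := by gcongr; exact le_self_add

lemma mixed_max_B (d : ℕ) (hd : 1 ≤ d) (q₁ q₂ : ℝ) (hq₁ : 1 < q₁) (h12 : q₁ < q₂) :
    ∃ C : ℝ≥0∞, C ≠ ∞ ∧ ∀ f : Pt d → ℝ≥0∞, Measurable f →
      ∫⁻ t : ℝ, (∫⁻ x : Ed d, pM d f (t, x) ^ q₁) ^ (q₂ / q₁) ≤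
        C * ∫⁻ t : ℝ, (∫⁻ x : Ed d, f (t, x) ^ q₁) ^ (q₂ / q₁) := by
  have p1 : 0 < q₁ := by linarith
  set p := q₂ / q₁ with hp
  have hp1 : 1 < p := (one_lt_div p1).2 h12
  have hp0 : 0 < p := by linarith
  set p' := p.conjExponent with hp'
  have hpp : p.HolderConjugate p' := Real.HolderConjugate.conjExponent hp1
  have hp'1 : 1 < p' := hpp.symm.lt
  obtain ⟨C1, hC1, hC1t⟩ : ∃ C1 : ℝ≥0∞, C1 ≠ ∞ ∧ ∀ f : Pt d → ℝ≥0∞, Measurable f →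
      ∀ w : ℝ → ℝ≥0∞, Measurable w →
      ∫⁻ z : Pt d, w z.1 * pM d f z ^ q₁ ≤ C1 * ∫⁻ z : Pt d, tM w z.1 * f z ^ q₁ :=
    ⟨_, by finiteness, fun f hf w hw => pM_fs d hd q₁ hq₁ f hf w hw⟩
  obtain ⟨C2, hC2, hC2t⟩ : ∃ C1 : ℝ≥0∞, C1 ≠ ∞ ∧ ∀ g : ℝ → ℝ≥0∞, Measurable g →
      ∫⁻ z, tM g z ^ p' ≤ C1 * ∫⁻ z, g z ^ p' :=
    ⟨_, by finiteness, fun g hg => tM_strong p' hp'1 g hg⟩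
  have hp'0 : 0 < p' := by linarith
  set D := C1 * C2 ^ (1 / p') with hD
  have hDt : D ≠ ∞ := by
    have : 0 ≤ 1 / p' := by positivity
    finiteness
  refine ⟨D ^ p, by finiteness, fun f hf => ?_⟩
  set Φ : ℝ → ℝ≥0∞ := fun t => ∫⁻ x : Ed d, pM d f (t, x) ^ q₁ with hΦ
  set Γ : ℝ → ℝ≥0∞ := fun t => ∫⁻ x : Ed d, f (t, x) ^ q₁ with hΓ
  have mΦ : Measurable Φ := slice_meas d q₁ _ (pM_meas d hd f hf)
  have mΓ : Measurable Γ := slice_meas d q₁ _ hf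
  have hdual : ∀ w : ℝ → ℝ≥0∞, Measurable w →
      ∫⁻ t, w t * Φ t ≤ D * (∫⁻ t, Γ t ^ p) ^ (1 / p) * (∫⁻ t, w t ^ p') ^ (1 / p') := by
    intro w hw
    have e1 : ∫⁻ z : Pt d, w z.1 * pM d f z ^ q₁ = ∫⁻ t, w t * Φ t := by
      rw [Measure.volume_eq_prod, lintegral_prod]
      · refine lintegral_congr fun t => ?_
        have ms : Measurable fun x : Ed d => pM d f (t, x) ^ q₁ :=
          ((pM_meas d hd f hf).comp measurable_prodMk_left).pow_const _
        show ∫⁻ x : Ed d, w t * pM d f (t, x) ^ q₁ = w t * ∫⁻ x : Ed d, pM d f (t, x) ^ q₁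
        rw [lintegral_const_mul _ ms]
      · exact ((hw.comp measurable_fst).mul ((pM_meas d hd f hf).pow_const _)).aemeasurable
    have e2 : ∫⁻ z : Pt d, tM w z.1 * f z ^ q₁ = ∫⁻ t, tM w t * Γ t := by
      rw [Measure.volume_eq_prod, lintegral_prod]
      · refine lintegral_congr fun t => ?_
        have ms : Measurable fun x : Ed d => f (t, x) ^ q₁ :=
          (hf.comp measurable_prodMk_left).pow_const _
        show ∫⁻ x : Ed d, tM w t * f (t, x) ^ q₁ = tM w t * ∫⁻ x : Ed d, f (t, x) ^ q₁
        rw [lintegral_const_mul _ ms]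
      · exact (((tM_meas w hw).comp measurable_fst).mul (hf.pow_const _)).aemeasurable
    rw [← e1]
    refine (hC1t f hf w hw).trans ?_
    rw [e2]
    have e3 := ENNReal.lintegral_mul_le_Lp_mul_Lq volume hpp.symm (tM_meas w hw).aemeasurable
      mΓ.aemeasurable
    simp only [Pi.mul_apply] at e3
    calc C1 * ∫⁻ t, tM w t * Γ t
        ≤ C1 * ((C2 * ∫⁻ t, w t ^ p') ^ (1 / p') * (∫⁻ t, Γ t ^ p) ^ (1 / p)) := by
          refine mul_le_mul_right (e3.trans ?_) _
          gcongr
          exact hC2t w hw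
      _ = _ := by
          rw [ENNReal.mul_rpow_of_nonneg _ _ (by positivity), hD]; ring
  set A := D * (∫⁻ t, Γ t ^ p) ^ (1 / p) with hA
  have hAp : A ^ p = D ^ p * ∫⁻ t, Γ t ^ p := by
    rw [hA, ENNReal.mul_rpow_of_nonneg _ _ hp0.le, ← ENNReal.rpow_mul,
      one_div_mul_cancel hp0.ne', ENNReal.rpow_one]
  rw [← hAp]

  let Ψ : ℕ → ℝ → ℝ≥0∞ := fun n => (Icc (-(n:ℝ)) n).indicator fun t => min (Φ t) n
  have mΨ : ∀ n, Measurable (Ψ n) := fun n =>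
    (mΦ.min measurable_const).indicator measurableSet_Icc
  have hΨle : ∀ n t, Ψ n t ≤ Φ t := fun n t => by
    simp only [Ψ, indicator]; split_ifs
    · exact min_le_left _ _
    · exact zero_le
  have hmono : Monotone Ψ := by
    intro m n hmn t
    have hmn' : (m:ℝ) ≤ n := by exact_mod_cast hmn
    simp only [Ψ]
    by_cases hm : t ∈ Icc (-(m:ℝ)) m
    · have hn : t ∈ Icc (-(n:ℝ)) n := ⟨by linarith [hm.1], by linarith [hm.2]⟩
      rw [indicator_of_mem hm, indicator_of_mem hn]
      refine min_le_min le_rfl (by exact_mod_cast hmn)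
    · rw [indicator_of_notMem hm]; exact zero_le
  have hsup : ∀ t, ⨆ n, Ψ n t = Φ t := by
    intro t
    refine le_antisymm (iSup_le fun n => hΨle n t) ?_
    refine le_of_forall_lt fun a ha => ?_
    have hat : a ≠ ∞ := ha.ne_top
    obtain ⟨n, hn⟩ := ENNReal.exists_nat_gt hat
    obtain ⟨m, hm⟩ := exists_nat_ge |t|
    refine lt_of_lt_of_le ?_ (le_iSup (fun n => Ψ n t) (max n m))
    have hmem : t ∈ Icc (-((max n m : ℕ):ℝ)) (max n m : ℕ) := by
      have h1 : |t| ≤ ((max n m : ℕ):ℝ) := hm.trans (by exact_mod_cast le_max_right _ _)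
      exact abs_le.1 h1
    simp only [Ψ]
    rw [indicator_of_mem hmem]
    refine lt_min ha (hn.trans_le ?_)
    exact_mod_cast le_max_left _ _
  have hbound : ∀ n, ∫⁻ t, Ψ n t ^ p ≤ A ^ p := by
    intro n
    set J := ∫⁻ t, Ψ n t ^ p with hJ
    have hJt : J ≠ ∞ := by
      have : J ≤ ∫⁻ t in Icc (-(n:ℝ)) n, (n:ℝ≥0∞) ^ p := by
        rw [← lintegral_indicator measurableSet_Icc]
        refine lintegral_mono fun t => ?_
        simp only [Ψ, indicator]
        split_ifs
        · gcongr; exact min_le_right _ _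
        · simp [hp0]
      refine ne_top_of_le_ne_top ?_ this
      rw [setLIntegral_const, Real.volume_Icc]
      finiteness
    have hstep : J ≤ A * J ^ (1 / p') := by
      have h1 := hdual (fun t => Ψ n t ^ (p - 1)) ((mΨ n).pow_const _)
      have h2 : ∀ t, (Ψ n t ^ (p - 1)) ^ p' = Ψ n t ^ p := fun t => by
        rw [← ENNReal.rpow_mul]; congr 1
        exact hpp.sub_one_mul_conj
      simp only [h2] at h1
      refine le_trans (lintegral_mono fun t => ?_) h1
      calc Ψ n t ^ p = Ψ n t ^ (p - 1) * Ψ n t ^ (1:ℝ) := by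
            rw [← ENNReal.rpow_add_of_nonneg _ _ (by linarith) zero_le_one]; congr 1; ring
        _ ≤ _ := by rw [ENNReal.rpow_one]; gcongr; exact hΨle n t
    by_cases hJ0 : J = 0
    · rw [hJ0]; exact zero_le
    have h3 : J ^ (1 / p) ≤ A := by
      have hx : J ^ (1 / p') ≠ 0 := by simp [hJ0, hJt]
      have hxt : J ^ (1 / p') ≠ ∞ := by
        have : 0 ≤ 1 / p' := by positivity
        finiteness
      refine (ENNReal.mul_le_mul_iff_left hx hxt).1 (le_trans (le_of_eq ?_) hstep)
      rw [← ENNReal.rpow_add _ _ hJ0 hJt, one_div, one_div, hpp.inv_add_inv_eq_one,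
        ENNReal.rpow_one]
    calc J = (J ^ (1 / p)) ^ p := by
          rw [← ENNReal.rpow_mul, one_div_mul_cancel hp0.ne', ENNReal.rpow_one]
      _ ≤ A ^ p := by gcongr
  have hlim : ∀ t, Φ t ^ p = ⨆ n, Ψ n t ^ p := by
    intro t
    rw [← hsup t]
    exact (ENNReal.orderIsoRpow p hp0).map_iSup _
  calc ∫⁻ t, Φ t ^ p = ∫⁻ t, ⨆ n, Ψ n t ^ p := lintegral_congr hlim
    _ = ⨆ n, ∫⁻ t, Ψ n t ^ p := by
        refine lintegral_iSup (fun n => (mΨ n).pow_const p) fun m n hmn t => ?_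
        exact ENNReal.rpow_le_rpow (hmono hmn t) hp0.le
    _ ≤ A ^ p := iSup_le hbound

lemma mixed_max (d : ℕ) (hd : 1 ≤ d) (q₁ q₂ : ℝ) (hq₁ : 1 < q₁) (hq₂ : 1 < q₂) :
    ∃ C : ℝ≥0∞, C ≠ ∞ ∧ ∀ f : Pt d → ℝ≥0∞, Measurable f →
      MixedNorm d q₁ q₂ (pM d f) ≤ C * MixedNorm d q₁ q₂ f := by
  have p2 : 0 < q₂ := by linarith
  have h : ∃ C : ℝ≥0∞, C ≠ ∞ ∧ ∀ f : Pt d → ℝ≥0∞, Measurable f →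
      ∫⁻ t : ℝ, (∫⁻ x : Ed d, pM d f (t, x) ^ q₁) ^ (q₂ / q₁) ≤
        C * ∫⁻ t : ℝ, (∫⁻ x : Ed d, f (t, x) ^ q₁) ^ (q₂ / q₁) := by
    rcases le_or_gt q₂ q₁ with h | h
    · exact mixed_max_A d hd q₁ q₂ hq₁ hq₂ h
    · exact mixed_max_B d hd q₁ q₂ hq₁ h
  obtain ⟨C, hC, h⟩ := h
  have hn : 0 ≤ 1 / q₂ := by positivity
  refine ⟨C ^ (1 / q₂), by finiteness, fun f hf => ?_⟩
  unfold MixedNorm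
  rw [← ENNReal.mul_rpow_of_nonneg _ _ hn]
  exact ENNReal.rpow_le_rpow (h f hf) hn

/-! ### Kernel bounds and the Hedberg inequality -/

lemma ker_real (m s r : ℝ) (hm : 0 < m) (hs : 0 < s) :
    s ^ (-(m / 2)) * Real.exp (-(r ^ 2) / s) ≤
      (1 + (m / 2) ^ (m / 2)) * max (Real.sqrt s) r ^ (-m) := by
  have ha : 0 < m / 2 := by positivity
  have hC : 0 ≤ (m / 2) ^ (m / 2) := by positivity
  have hq : 0 < Real.sqrt s := Real.sqrt_pos.2 hs
  rcases le_or_gt r (Real.sqrt s) with h | h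
  · rw [max_eq_left h]
    have e1 : Real.sqrt s ^ (-m) = s ^ (-(m / 2)) := by
      rw [Real.sqrt_eq_rpow, ← Real.rpow_mul hs.le]; congr 1; ring
    rw [e1]
    have e2 : Real.exp (-(r ^ 2) / s) ≤ 1 := by
      rw [Real.exp_le_one_iff, neg_div]
      have : 0 ≤ r ^ 2 / s := by positivity
      linarith
    have e3 : 0 ≤ s ^ (-(m / 2)) := by positivity
    nlinarith [mul_nonneg hC e3]
  · rw [max_eq_right h.le]
    have hr0 : 0 < r := hq.trans h
    set x := r ^ 2 / s with hx
    have hx0 : 0 < x := by positivity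
    have hse : s = r ^ 2 / x := by rw [hx]; field_simp
    have e1 : s ^ (-(m / 2)) = r ^ (-m) * x ^ (m / 2) := by
      rw [hse, Real.div_rpow (by positivity) hx0.le, Real.rpow_neg hx0.le, div_inv_eq_mul]
      congr 1
      rw [← Real.rpow_natCast r 2, ← Real.rpow_mul hr0.le]; congr 1; push_cast; ring
    have e2 : (x / (m / 2)) ^ (m / 2) ≤ Real.exp x := by
      have h1 : x / (m / 2) ≤ Real.exp (x / (m / 2)) := by
        linarith [Real.add_one_le_exp (x / (m / 2))]
      calc (x / (m / 2)) ^ (m / 2) ≤ Real.exp (x / (m / 2)) ^ (m / 2) :=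
            Real.rpow_le_rpow (by positivity) h1 ha.le
        _ = Real.exp x := by
            rw [← Real.exp_mul]; congr 1; field_simp
    rw [Real.div_rpow hx0.le ha.le, div_le_iff₀ (by positivity)] at e2
    rw [e1, neg_div, ← hx, Real.exp_neg]
    have e3 : 0 < Real.exp x := Real.exp_pos x
    have e4 : x ^ (m / 2) * (Real.exp x)⁻¹ ≤ 1 + (m / 2) ^ (m / 2) := by
      rw [← div_eq_mul_inv, div_le_iff₀ e3]; nlinarith
    have e5 : 0 ≤ r ^ (-m) := by positivity
    calc r ^ (-m) * x ^ (m / 2) * (Real.exp x)⁻¹ = r ^ (-m) * (x ^ (m / 2) * (Real.exp x)⁻¹) := by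
          ring
      _ ≤ r ^ (-m) * (1 + (m / 2) ^ (m / 2)) := by gcongr
      _ = _ := by ring

/-- kernel constant -/
def cK (d : ℕ) (α : ℝ) : ℝ :=
  (1 + (((d:ℝ) + 2 - α) / 2) ^ (((d:ℝ) + 2 - α) / 2)) * ((d:ℝ) + 2 - α)

lemma ker_int (d : ℕ) (α : ℝ) (hα : α < (d:ℝ) + 2) (w : Pt d) :
    pKer d α w.1 ‖w.2‖ ≤ ENNReal.ofReal (cK d α) *
      ∫⁻ R in Ioi (0:ℝ), ENNReal.ofReal (R ^ (-((d:ℝ) + 2 - α) - 1)) *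
        (pCyl d R 0).indicator 1 w := by
  unfold pKer
  split_ifs with hs
  swap
  · exact zero_le
  unfold cK
  set m := (d:ℝ) + 2 - α with hm
  have hm0 : 0 < m := by linarith
  set ϱ := max (Real.sqrt w.1) ‖w.2‖ with hϱ
  have hϱ0 : 0 < ϱ := lt_max_of_lt_left (Real.sqrt_pos.2 hs)
  have h1 := ker_real m w.1 ‖w.2‖ hm0 hs
  calc ENNReal.ofReal (w.1 ^ (-(m / 2)) * Real.exp (-(‖w.2‖ ^ 2) / w.1))
      ≤ ENNReal.ofReal ((1 + (m / 2) ^ (m / 2)) * ϱ ^ (-m)) := ENNReal.ofReal_le_ofReal h1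
    _ = ENNReal.ofReal ((1 + (m / 2) ^ (m / 2)) * m) * ENNReal.ofReal (ϱ ^ (-m) / m) := by
        rw [← ENNReal.ofReal_mul (by positivity)]; congr 1; field_simp
    _ = ENNReal.ofReal ((1 + (m / 2) ^ (m / 2)) * m) *
          ∫⁻ R in Ioi ϱ, ENNReal.ofReal (R ^ (-m - 1)) := by rw [sc_Ioi m hm0 ϱ hϱ0]
    _ ≤ _ := by
        gcongr _ * ?_
        calc ∫⁻ R in Ioi ϱ, ENNReal.ofReal (R ^ (-m - 1))
            = ∫⁻ R in Ioi ϱ, ENNReal.ofReal (R ^ (-m - 1)) * (pCyl d R 0).indicator 1 w := by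
              refine setLIntegral_congr_fun measurableSet_Ioi fun R hR => ?_
              have hR' : ϱ < R := hR
              have : w ∈ pCyl d R 0 := by
                have a1 : ‖w.2‖ < R := (le_max_right _ _).trans_lt hR'
                have a2 : Real.sqrt w.1 < R := (le_max_left _ _).trans_lt hR'
                refine ⟨?_, ?_, ?_⟩
                · simpa using a1
                · exact hs.le
                · have := Real.lt_sq_of_sqrt_lt a2
                  simpa using this
              rw [indicator_of_mem this]; simp
          _ ≤ _ := lintegral_mono_set (Ioi_subset_Ioi hϱ0.le)

lemma Palpha_le (d : ℕ) (hd : 1 ≤ d) (α : ℝ) (hα : α < (d:ℝ) + 2) (f : Pt d → ℝ≥0∞)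
    (hf : Measurable f) (z : Pt d) :
    Palpha d α f z ≤ ENNReal.ofReal (cK d α) * V0 d *
      ∫⁻ R in Ioi (0:ℝ), ENNReal.ofReal (R ^ (α - 1)) * pAvg d R z f := by
  set m := (d:ℝ) + 2 - α with hm
  have hmem : ∀ (R : ℝ) (w : Pt d), w ∈ pCyl d R 0 ↔ z + w ∈ pCyl d R z := by
    intro R w
    simp only [pCyl, mem_ofPred_eq, Prod.fst_add, Prod.snd_add, Prod.fst_zero, Prod.snd_zero]
    constructor
    · rintro ⟨a, b, c⟩
      refine ⟨by simpa using a, by linarith, by linarith⟩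
    · rintro ⟨a, b, c⟩
      refine ⟨by simpa using a, by linarith, by linarith⟩
  have mset : MeasurableSet {p : Pt d × ℝ | p.1 ∈ pCyl d p.2 0} := by
    have : {p : Pt d × ℝ | p.1 ∈ pCyl d p.2 0} =
      {p | dist (0 : Ed d) p.1.2 < p.2} ∩ ({p | 0 ≤ p.1.1} ∩ {p | p.1.1 < 0 + p.2 ^ 2}) := by
      ext p; simp [pCyl]
    rw [this]
    refine (measurableSet_lt ?_ ?_).inter ((measurableSet_le ?_ ?_).inter (measurableSet_lt ?_ ?_))
    all_goals fun_prop
  calc Palpha d α f z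
      ≤ ∫⁻ w : Pt d, (ENNReal.ofReal (cK d α) *
          ∫⁻ R in Ioi (0:ℝ), ENNReal.ofReal (R ^ (-m - 1)) * (pCyl d R 0).indicator 1 w) *
            f (z + w) := by
        refine lintegral_mono fun w => ?_
        exact mul_le_mul_left (ker_int d α hα w) _
    _ = ∫⁻ w : Pt d, ENNReal.ofReal (cK d α) *
          ∫⁻ R in Ioi (0:ℝ), ENNReal.ofReal (R ^ (-m - 1)) * (pCyl d R z).indicator f (z + w) := by
        refine lintegral_congr fun w => ?_
        have mm : Measurable fun R : ℝ => ENNReal.ofReal (R ^ (-m - 1)) *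
            (pCyl d R 0).indicator (1 : Pt d → ℝ≥0∞) w := by
          refine Measurable.mul (by fun_prop) ?_
          have : (fun R : ℝ => (pCyl d R 0).indicator (1 : Pt d → ℝ≥0∞) w) =
            (((fun R : ℝ => (w, R)) ⁻¹' {p : Pt d × ℝ | p.1 ∈ pCyl d p.2 0}).indicator 1) := by
            funext R; simp only [indicator, mem_preimage, mem_ofPred_eq, Pi.one_apply]
            congr 1
          rw [this]
          exact measurable_one.indicator (measurable_prodMk_left mset)
        rw [mul_assoc, ← lintegral_mul_const _ mm]
        congr 1
        refine lintegral_congr fun R => ?_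
        rw [mul_assoc]; congr 1
        by_cases h : w ∈ pCyl d R 0
        · rw [indicator_of_mem h, indicator_of_mem ((hmem R w).1 h)]; simp
        · rw [indicator_of_notMem h, indicator_of_notMem (fun h' => h ((hmem R w).2 h'))]; simp
    _ = ENNReal.ofReal (cK d α) * ∫⁻ w : Pt d,
          ∫⁻ R in Ioi (0:ℝ), ENNReal.ofReal (R ^ (-m - 1)) * (pCyl d R z).indicator f (z + w) := by
        rw [lintegral_const_mul' _ _ ENNReal.ofReal_ne_top]
    _ = ENNReal.ofReal (cK d α) * ∫⁻ R in Ioi (0:ℝ),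
          ∫⁻ w : Pt d, ENNReal.ofReal (R ^ (-m - 1)) * (pCyl d R z).indicator f (z + w) := by
        congr 1
        refine lintegral_lintegral_swap (Measurable.aemeasurable ?_)
        have : (Function.uncurry fun (w : Pt d) (R : ℝ) =>
            ENNReal.ofReal (R ^ (-m - 1)) * (pCyl d R z).indicator f (z + w)) =
            fun p : Pt d × ℝ => ENNReal.ofReal (p.2 ^ (-m - 1)) *
              ({p : Pt d × ℝ | p.1 ∈ pCyl d p.2 0}.indicator (fun p => f (z + p.1)) p) := by
          funext p
          show ENNReal.ofReal (p.2 ^ (-m - 1)) * (pCyl d p.2 z).indicator f (z + p.1) = _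
          congr 1
          by_cases h : p.1 ∈ pCyl d p.2 0
          · have h2 : p ∈ {p : Pt d × ℝ | p.1 ∈ pCyl d p.2 0} := h
            rw [indicator_of_mem ((hmem _ _).1 h), indicator_of_mem h2]
          · have h2 : p ∉ {p : Pt d × ℝ | p.1 ∈ pCyl d p.2 0} := h
            rw [indicator_of_notMem (fun h' => h ((hmem _ _).2 h')), indicator_of_notMem h2]
        rw [this]
        refine Measurable.mul (by fun_prop) (Measurable.indicator ?_ mset)
        exact hf.comp (by fun_prop)
    _ = ENNReal.ofReal (cK d α) * ∫⁻ R in Ioi (0:ℝ), V0 d *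
          (ENNReal.ofReal (R ^ (α - 1)) * pAvg d R z f) := by
        congr 1
        refine setLIntegral_congr_fun measurableSet_Ioi fun R hR => ?_
        have hR0 : 0 < R := hR
        have : (volume : Measure (Pt d)).IsAddLeftInvariant := by
          rw [Measure.volume_eq_prod]; infer_instance
        rw [lintegral_const_mul' _ _ ENNReal.ofReal_ne_top,
          lintegral_add_left_eq_self (fun w => (pCyl d R z).indicator f w) z,
          lintegral_indicator (pCyl_meas d R z)]
        unfold pAvg
        rw [vol_pCyl d hd z R hR0.le]
        have hne : ENNReal.ofReal (R ^ (d + 2)) ≠ 0 := by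
          simp only [ne_eq, ENNReal.ofReal_eq_zero, not_le]; positivity
        rw [ENNReal.mul_inv (Or.inl hne) (Or.inl ENNReal.ofReal_ne_top)]
        have e : ENNReal.ofReal (R ^ (-m - 1)) =
            ENNReal.ofReal (R ^ (α - 1)) * (ENNReal.ofReal (R ^ (d + 2)))⁻¹ := by
          rw [← ENNReal.ofReal_inv_of_pos (by positivity), ← ENNReal.ofReal_mul (by positivity)]
          congr 1
          rw [← Real.rpow_natCast R (d + 2), ← Real.rpow_neg hR0.le, ← Real.rpow_add hR0]
          congr 1; push_cast; rw [hm]; ring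
        rw [e]
        calc _ = (V0 d * (V0 d)⁻¹) * (ENNReal.ofReal (R ^ (α - 1)) *
            (ENNReal.ofReal (R ^ (d + 2)))⁻¹ * ∫⁻ w in pCyl d R z, f w) := by
              rw [ENNReal.mul_inv_cancel (V0_pos d) (V0_top d), one_mul]
          _ = _ := by ring
    _ = _ := by rw [lintegral_const_mul' _ _ (V0_top d), mul_assoc]

lemma pAvg_le_pM (d : ℕ) (hd : 1 ≤ d) (f : Pt d → ℝ≥0∞) (R : ℝ) (hR : 0 < R) (z : Pt d) :
    pAvg d R z f ≤ 2 ^ (d + 2) * pM d f z := by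
  obtain ⟨k, hk1, hk2⟩ := exists_mem_Ioc_zpow hR (one_lt_two : (1:ℝ) < 2)
  set S := (2:ℝ) ^ (k + 1) with hS
  have hS0 : 0 < S := by positivity
  have hSR : S ≤ 2 * R := by rw [hS, zpow_add_one₀ two_ne_zero]; linarith
  have hsub : pCyl d R z ⊆ pCyl d S z := by
    rintro w ⟨a, b, c⟩
    refine ⟨a.trans_le hk2, b, c.trans_le ?_⟩
    have : R ^ 2 ≤ S ^ 2 := by gcongr
    linarith
  refine le_trans ?_ (mul_le_mul_right (le_iSup (fun k : ℤ => pAvg d (2 ^ k) z f) (k + 1)) _)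
  show _ ≤ 2 ^ (d + 2) * pAvg d S z f
  unfold pAvg
  rw [← mul_assoc]
  refine mul_le_mul' ?_ (lintegral_mono_set hsub)
  rw [vol_pCyl d hd z R hR.le, vol_pCyl d hd z S hS0.le]
  have hne : ∀ x : ℝ, 0 < x → ENNReal.ofReal (x ^ (d + 2)) ≠ 0 := fun x hx => by
    simp only [ne_eq, ENNReal.ofReal_eq_zero, not_le]; positivity
  rw [ENNReal.mul_inv (Or.inl (hne R hR)) (Or.inl ENNReal.ofReal_ne_top),
    ENNReal.mul_inv (Or.inl (hne S hS0)) (Or.inl ENNReal.ofReal_ne_top), ← mul_assoc]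
  refine mul_le_mul_left ?_ _
  rw [← ENNReal.ofReal_inv_of_pos (by positivity), ← ENNReal.ofReal_inv_of_pos (by positivity),
    show (2 : ℝ≥0∞) ^ (d + 2) = ENNReal.ofReal (2 ^ (d + 2)) by
      rw [ENNReal.ofReal_pow (by norm_num)]; simp,
    ← ENNReal.ofReal_mul (by positivity)]
  refine ENNReal.ofReal_le_ofReal ?_
  rw [← div_eq_mul_inv, le_div_iff₀ (by positivity), inv_mul_le_iff₀ (by positivity), ← mul_pow]
  rw [mul_comm]
  gcongr

lemma hedberg (α β : ℝ) (hα : 0 < α) (hαβ : α < β) (a : ℝ → ℝ≥0∞) (A K : ℝ≥0∞) (hK : K ≠ ∞)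
    (h1 : ∀ R, 0 < R → a R ≤ A) (h2 : ∀ R, 0 < R → a R ≤ K * ENNReal.ofReal (R ^ (-β))) :
    ∫⁻ R in Ioi (0:ℝ), ENNReal.ofReal (R ^ (α - 1)) * a R ≤
      ENNReal.ofReal (1 / α + 1 / (β - α)) * (K ^ (α / β) * A ^ (1 - α / β)) := by
  have hβ : 0 < β := by linarith
  have hαb : 0 < α / β := by positivity
  have hab1 : 0 < 1 - α / β := by
    rw [sub_pos, div_lt_one hβ]; exact hαβ
  have hba : 0 < β - α := by linarith
  have zero_case : (∀ R, 0 < R → a R = 0) →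
      ∫⁻ R in Ioi (0:ℝ), ENNReal.ofReal (R ^ (α - 1)) * a R = 0 := by
    intro h
    rw [setLIntegral_congr_fun (g := fun _ => 0) measurableSet_Ioi
      (fun R hR => by simp [h R hR])]
    simp
  by_cases hK0 : K = 0
  · rw [zero_case fun R hR => by simpa [hK0] using h2 R hR]; exact zero_le
  by_cases hA0 : A = 0
  · rw [zero_case fun R hR => by simpa [hA0] using h1 R hR]; exact zero_le
  by_cases hAt : A = ∞
  · rw [hAt, ENNReal.top_rpow_of_pos hab1, ENNReal.mul_top, ENNReal.mul_top]
    · exact le_top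
    · simp only [ne_eq, ENNReal.ofReal_eq_zero, not_le]; positivity
    · simp [hK0, hK]
  have hk : 0 < K.toReal := ENNReal.toReal_pos hK0 hK
  have ha : 0 < A.toReal := ENNReal.toReal_pos hA0 hAt
  rw [← ENNReal.ofReal_toReal hK] at h2 ⊢
  rw [← ENNReal.ofReal_toReal hAt] at h1 ⊢
  set k := K.toReal
  set b := A.toReal
  set R0 := (k / b) ^ (1 / β) with hR0
  have hR0p : 0 < R0 := by positivity
  rw [← Ioc_union_Ioi_eq_Ioi hR0p.le, lintegral_union measurableSet_Ioi
    (Ioc_disjoint_Ioi le_rfl)]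
  have n1 : ∫⁻ R in Ioc 0 R0, ENNReal.ofReal (R ^ (α - 1)) * a R ≤
      ENNReal.ofReal (R0 ^ α / α) * ENNReal.ofReal b := by
    rw [← sc_Ioc α hα R0 hR0p.le, ← lintegral_mul_const' _ _ ENNReal.ofReal_ne_top]
    refine setLIntegral_mono' measurableSet_Ioc fun R hR => ?_
    gcongr; exact h1 R hR.1
  have n2 : ∫⁻ R in Ioi R0, ENNReal.ofReal (R ^ (α - 1)) * a R ≤
      ENNReal.ofReal (R0 ^ (-(β - α)) / (β - α)) * ENNReal.ofReal k := by
    rw [← sc_Ioi (β - α) hba R0 hR0p, ← lintegral_mul_const' _ _ ENNReal.ofReal_ne_top]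
    refine setLIntegral_mono' measurableSet_Ioi fun R hR => ?_
    have hRp : 0 < R := hR0p.trans hR
    calc ENNReal.ofReal (R ^ (α - 1)) * a R
        ≤ ENNReal.ofReal (R ^ (α - 1)) * (ENNReal.ofReal k * ENNReal.ofReal (R ^ (-β))) := by
          gcongr; exact h2 R hRp
      _ = (ENNReal.ofReal (R ^ (α - 1)) * ENNReal.ofReal (R ^ (-β))) * ENNReal.ofReal k := by ring
      _ = _ := by
          rw [← ENNReal.ofReal_mul (by positivity), ← Real.rpow_add hRp]
          congr 3; ring
  refine (add_le_add n1 n2).trans (le_of_eq ?_)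
  rw [ENNReal.ofReal_rpow_of_pos hk, ENNReal.ofReal_rpow_of_pos ha,
    ← ENNReal.ofReal_mul (by positivity), ← ENNReal.ofReal_mul (by positivity),
    ← ENNReal.ofReal_mul (by positivity), ← ENNReal.ofReal_mul (by positivity),
    ← ENNReal.ofReal_add (by positivity) (by positivity)]
  congr 1
  have f1 : R0 ^ α * b = k ^ (α / β) * b ^ (1 - α / β) := by
    rw [hR0, ← Real.rpow_mul (by positivity), Real.div_rpow hk.le ha.le, Real.rpow_sub ha,
      Real.rpow_one, show 1 / β * α = α / β by ring]
    ring
  have f2 : R0 ^ (-(β - α)) * k = k ^ (α / β) * b ^ (1 - α / β) := by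
    rw [hR0, ← Real.rpow_mul (by positivity), Real.div_rpow hk.le ha.le,
      show 1 / β * -(β - α) = α / β - 1 by field_simp; ring, Real.rpow_sub hk, Real.rpow_one,
      show α / β - 1 = -(1 - α / β) by ring, Real.rpow_neg ha.le]
    have := (Real.rpow_pos_of_pos ha (1 - α / β)).ne'
    field_simp
  calc R0 ^ α / α * b + R0 ^ (-(β - α)) / (β - α) * k
      = (R0 ^ α * b) / α + (R0 ^ (-(β - α)) * k) / (β - α) := by ring
    _ = _ := by rw [f1, f2]; ring

lemma pointwise (d : ℕ) (hd : 1 ≤ d) (α β : ℝ) (hα : 0 < α) (hαβ : α < β)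
    (hαd : α < (d:ℝ) + 2) :
    ∃ C : ℝ≥0∞, C ≠ ∞ ∧ ∀ f : Pt d → ℝ≥0∞, Measurable f → ∀ K : ℝ≥0∞, K ≠ ∞ →
      (∀ (R : ℝ) (z : Pt d), 0 < R → ENNReal.ofReal (R ^ β) * pAvg d R z f ≤ K) →
      ∀ (ρ : ℝ) (z₀ z : Pt d), 0 < ρ → z ∈ pCyl d ρ z₀ →
        Palpha d α f z ≤ C * K ^ (α / β) * pM d ((pCyl d (2 * ρ) z₀).indicator f) z ^ (1 - α / β)
          + C * K * ENNReal.ofReal (ρ ^ (α - β)) := by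
  have hβ : 0 < β := by linarith
  have hba : 0 < β - α := by linarith
  have hab1 : 0 < 1 - α / β := by
    rw [sub_pos, div_lt_one hβ]; exact hαβ
  set c := ENNReal.ofReal (cK d α) * V0 d with hc
  have hct : c ≠ ∞ := ENNReal.mul_ne_top ENNReal.ofReal_ne_top (V0_top d)
  set c1 := c * (ENNReal.ofReal (1 / α + 1 / (β - α)) * ((2:ℝ≥0∞) ^ (d + 2)) ^ (1 - α / β)) with hc1
  set c2 := c * ENNReal.ofReal (1 / (β - α)) with hc2
  have hc1t : c1 ≠ ∞ := by finiteness
  have hc2t : c2 ≠ ∞ := by finiteness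
  refine ⟨c1 + c2, by finiteness, fun f hf K hK h ρ z₀ z hρ hz => ?_⟩
  set g := (pCyl d (2 * ρ) z₀).indicator f with hg
  have h2 : ∀ R, 0 < R → pAvg d R z f ≤ K * ENNReal.ofReal (R ^ (-β)) := by
    intro R hR
    have := h R z hR
    rw [Real.rpow_neg hR.le, ENNReal.ofReal_inv_of_pos (by positivity), ← div_eq_mul_inv,
      ENNReal.le_div_iff_mul_le (Or.inl _) (Or.inl ENNReal.ofReal_ne_top), mul_comm]
    · exact this
    · simp only [ne_eq, ENNReal.ofReal_eq_zero, not_le]; positivity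
  have hloc : ∀ R, 0 < R → R ≤ ρ → pAvg d R z f = pAvg d R z g := by
    intro R hR hRρ
    unfold pAvg
    congr 1
    refine setLIntegral_congr_fun (pCyl_meas d R z) fun w hw => ?_
    have : w ∈ pCyl d (2 * ρ) z₀ := by
      obtain ⟨a, b, e⟩ := hw
      obtain ⟨a', b', e'⟩ := hz
      refine ⟨?_, by linarith, ?_⟩
      · linarith [dist_triangle z₀.2 z.2 w.2]
      · have : R ^ 2 ≤ ρ ^ 2 := by gcongr
        nlinarith
    rw [hg, indicator_of_mem this]
  have near := hedberg α β hα hαβ (fun R => if R ≤ ρ then pAvg d R z f else 0)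
    (2 ^ (d + 2) * pM d g z) K hK
    (fun R hR => by
      split_ifs with hRρ
      · rw [hloc R hR hRρ]; exact pAvg_le_pM d hd g R hR z
      · exact zero_le)
    (fun R hR => by
      split_ifs with hRρ
      · exact h2 R hR
      · exact zero_le)
  have far : ∫⁻ R in Ioi ρ, ENNReal.ofReal (R ^ (α - 1)) * pAvg d R z f ≤
      ENNReal.ofReal (ρ ^ (-(β - α)) / (β - α)) * K := by
    rw [← sc_Ioi (β - α) hba ρ hρ, ← lintegral_mul_const' _ _ hK]
    refine setLIntegral_mono' measurableSet_Ioi fun R hR => ?_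
    have hRp : 0 < R := hρ.trans hR
    calc ENNReal.ofReal (R ^ (α - 1)) * pAvg d R z f
        ≤ ENNReal.ofReal (R ^ (α - 1)) * (K * ENNReal.ofReal (R ^ (-β))) := by
          gcongr; exact h2 R hRp
      _ = (ENNReal.ofReal (R ^ (α - 1)) * ENNReal.ofReal (R ^ (-β))) * K := by ring
      _ = _ := by
          rw [← ENNReal.ofReal_mul (by positivity), ← Real.rpow_add hRp]
          congr 3; ring
  have near' : ∫⁻ R in Ioc 0 ρ, ENNReal.ofReal (R ^ (α - 1)) * pAvg d R z f ≤
      ∫⁻ R in Ioi (0:ℝ), ENNReal.ofReal (R ^ (α - 1)) *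
        (if R ≤ ρ then pAvg d R z f else 0) := by
    calc _ = ∫⁻ R in Ioc 0 ρ, ENNReal.ofReal (R ^ (α - 1)) *
        (if R ≤ ρ then pAvg d R z f else 0) := by
          refine setLIntegral_congr_fun measurableSet_Ioc fun R hR => ?_
          simp [hR.2]
      _ ≤ _ := lintegral_mono_set Ioc_subset_Ioi_self
  calc Palpha d α f z
      ≤ c * ∫⁻ R in Ioi (0:ℝ), ENNReal.ofReal (R ^ (α - 1)) * pAvg d R z f :=
        Palpha_le d hd α hαd f hf z
    _ ≤ c * (ENNReal.ofReal (1 / α + 1 / (β - α)) *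
          (K ^ (α / β) * (2 ^ (d + 2) * pM d g z) ^ (1 - α / β)) +
          ENNReal.ofReal (ρ ^ (-(β - α)) / (β - α)) * K) := by
        gcongr c * ?_
        rw [← Ioc_union_Ioi_eq_Ioi hρ.le, lintegral_union measurableSet_Ioi
          (Ioc_disjoint_Ioi le_rfl)]
        exact add_le_add (near'.trans near) far
    _ = c1 * K ^ (α / β) * pM d g z ^ (1 - α / β) + c2 * K * ENNReal.ofReal (ρ ^ (α - β)) := by
        rw [ENNReal.mul_rpow_of_nonneg _ _ hab1.le, hc1, hc2, div_eq_mul_inv (ρ ^ (-(β - α))),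
          ENNReal.ofReal_mul (by positivity), one_div (β - α), neg_sub]
        ring
    _ ≤ _ := by
        gcongr
        · exact le_self_add
        · exact le_add_self

/-! ### Mixed norm algebra -/

lemma MixedNorm_mono (d : ℕ) (q₁ q₂ : ℝ) (h1 : 0 < q₁) (h2 : 0 < q₂) (f g : Pt d → ℝ≥0∞)
    (h : ∀ z, f z ≤ g z) : MixedNorm d q₁ q₂ f ≤ MixedNorm d q₁ q₂ g := by
  unfold MixedNorm
  have := div_pos h2 h1
  gcongr with t x
  exact h (t, x)

lemma MixedNorm_smul (d : ℕ) (q₁ q₂ : ℝ) (h1 : 0 < q₁) (h2 : 0 < q₂) (c : ℝ≥0∞) (hc : c ≠ ∞)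
    (f : Pt d → ℝ≥0∞) : MixedNorm d q₁ q₂ (fun z => c * f z) = c * MixedNorm d q₁ q₂ f := by
  unfold MixedNorm
  have h3 := div_pos h2 h1
  have hc1 : c ^ q₁ ≠ ∞ := by finiteness
  have hc2 : c ^ q₂ ≠ ∞ := by finiteness
  simp only [ENNReal.mul_rpow_of_nonneg _ _ h1.le]
  simp only [lintegral_const_mul' _ _ hc1]
  simp only [ENNReal.mul_rpow_of_nonneg _ _ h3.le, ← ENNReal.rpow_mul,
    show q₁ * (q₂ / q₁) = q₂ by field_simp]
  rw [lintegral_const_mul' _ _ hc2, ENNReal.mul_rpow_of_nonneg _ _ (by positivity),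
    ← ENNReal.rpow_mul, mul_one_div_cancel h2.ne', ENNReal.rpow_one]

lemma MixedNorm_pow (d : ℕ) (q₁ q₂ r₁ r₂ θ : ℝ) (h1 : 0 < q₁) (h2 : 0 < q₂) (hθ : 0 < θ)
    (e1 : r₁ * θ = q₁) (e2 : r₂ * θ = q₂) (f : Pt d → ℝ≥0∞) :
    MixedNorm d r₁ r₂ (fun z => f z ^ θ) = MixedNorm d q₁ q₂ f ^ θ := by
  unfold MixedNorm
  have hr1 : r₁ ≠ 0 := by rintro rfl; simp at e1; linarith
  have hr2 : r₂ ≠ 0 := by rintro rfl; simp at e2; linarith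
  simp only [← ENNReal.rpow_mul]
  rw [mul_comm θ, e1, show r₂ / r₁ = q₂ / q₁ by rw [← e1, ← e2]; field_simp,
    show 1 / q₂ * θ = 1 / r₂ by rw [← e2]; field_simp]

lemma MixedNorm_add (d : ℕ) (r₁ r₂ : ℝ) (h1 : 1 ≤ r₁) (h2 : 1 ≤ r₂) (f g : Pt d → ℝ≥0∞)
    (hf : Measurable f) (hg : Measurable g) :
    MixedNorm d r₁ r₂ (fun z => f z + g z) ≤ MixedNorm d r₁ r₂ f + MixedNorm d r₁ r₂ g := by
  have p1 : 0 < r₁ := by linarith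
  have p2 : 0 < r₂ := by linarith
  have key : ∀ F : Pt d → ℝ≥0∞, MixedNorm d r₁ r₂ F =
      (∫⁻ t : ℝ, ((∫⁻ x : Ed d, F (t, x) ^ r₁) ^ (1 / r₁)) ^ r₂) ^ (1 / r₂) := by
    intro F
    unfold MixedNorm
    simp only [← ENNReal.rpow_mul, show 1 / r₁ * r₂ = r₂ / r₁ by ring]
  rw [key, key f, key g]
  have mf : Measurable fun t : ℝ => (∫⁻ x : Ed d, f (t, x) ^ r₁) ^ (1 / r₁) :=
    (slice_meas d r₁ f hf).pow_const _
  have mg : Measurable fun t : ℝ => (∫⁻ x : Ed d, g (t, x) ^ r₁) ^ (1 / r₁) :=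
    (slice_meas d r₁ g hg).pow_const _
  refine le_trans ?_ (ENNReal.lintegral_Lp_add_le mf.aemeasurable mg.aemeasurable h2)
  have : 0 ≤ 1 / r₂ := by positivity
  refine ENNReal.rpow_le_rpow (lintegral_mono fun t => ?_) this
  refine ENNReal.rpow_le_rpow ?_ p2.le
  have sf : Measurable fun x : Ed d => f (t, x) := hf.comp measurable_prodMk_left
  have sg : Measurable fun x : Ed d => g (t, x) := hg.comp measurable_prodMk_left
  exact ENNReal.lintegral_Lp_add_le sf.aemeasurable sg.aemeasurable h1

lemma MixedNorm_ind (d : ℕ) (q₁ q₂ : ℝ) (h1 : 0 < q₁) (h2 : 0 < q₂) (ρ : ℝ) (z : Pt d)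
    (f : Pt d → ℝ≥0∞) :
    MixedNorm d q₁ q₂ ((pCyl d ρ z).indicator f) =
      (∫⁻ t in Ico z.1 (z.1 + ρ ^ 2), (∫⁻ x in Metric.ball z.2 ρ, f (t, x) ^ q₁) ^ (q₂ / q₁))
        ^ (1 / q₂) := by
  unfold MixedNorm
  have h3 := div_pos h2 h1
  congr 1
  rw [← lintegral_indicator measurableSet_Ico]
  refine lintegral_congr fun t => ?_
  rw [pCyl_eq]
  by_cases ht : t ∈ Ico z.1 (z.1 + ρ ^ 2)
  · rw [indicator_of_mem ht, ← lintegral_indicator Metric.isOpen_ball.measurableSet]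
    congr 1
    refine lintegral_congr fun x => ?_
    by_cases hx : x ∈ Metric.ball z.2 ρ
    · have : (t, x) ∈ Ico z.1 (z.1 + ρ ^ 2) ×ˢ Metric.ball z.2 ρ := ⟨ht, hx⟩
      rw [indicator_of_mem this, indicator_of_mem hx]
    · have : (t, x) ∉ Ico z.1 (z.1 + ρ ^ 2) ×ˢ Metric.ball z.2 ρ := fun h => hx h.2
      rw [indicator_of_notMem this, indicator_of_notMem hx, ENNReal.zero_rpow_of_pos h1]
  · rw [indicator_of_notMem ht]
    have : ∀ x : Ed d, (Ico z.1 (z.1 + ρ ^ 2) ×ˢ Metric.ball z.2 ρ).indicator f (t, x) ^ q₁ = 0 := by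
      intro x
      have : (t, x) ∉ Ico z.1 (z.1 + ρ ^ 2) ×ˢ Metric.ball z.2 ρ := fun h => ht h.1
      rw [indicator_of_notMem this, ENNReal.zero_rpow_of_pos h1]
    simp [this, h3]

/-- volume of a ball of radius ρ -/
def vB (d : ℕ) (ρ : ℝ) : ℝ≥0∞ := ENNReal.ofReal (ρ ^ d) * V0 d

lemma vB_pos (d : ℕ) (ρ : ℝ) (hρ : 0 < ρ) : vB d ρ ≠ 0 := by
  refine mul_ne_zero ?_ (V0_pos d)
  simp only [ne_eq, ENNReal.ofReal_eq_zero, not_le]; positivity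

lemma vB_top (d : ℕ) (ρ : ℝ) : vB d ρ ≠ ∞ := ENNReal.mul_ne_top ENNReal.ofReal_ne_top (V0_top d)

lemma vI_pos (ρ : ℝ) (hρ : 0 < ρ) : ENNReal.ofReal (ρ ^ 2) ≠ 0 := by
  simp only [ne_eq, ENNReal.ofReal_eq_zero, not_le]; positivity

lemma N_cyl (d : ℕ) (hd : 1 ≤ d) (q₁ q₂ : ℝ) (h1 : 0 < q₁) (h2 : 0 < q₂) (ρ : ℝ) (hρ : 0 < ρ)
    (z : Pt d) :
    MixedNorm d q₁ q₂ ((pCyl d ρ z).indicator 1) =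
      vB d ρ ^ (1 / q₁) * ENNReal.ofReal (ρ ^ 2) ^ (1 / q₂) := by
  rw [MixedNorm_ind d q₁ q₂ h1 h2]
  simp only [Pi.one_apply, ENNReal.one_rpow, setLIntegral_const, one_mul, Real.volume_Ico,
    add_sub_cancel_left]
  rw [vol_ball d hd _ _ hρ.le, ENNReal.mul_rpow_of_nonneg _ _ (by positivity),
    ← ENNReal.rpow_mul, show q₂ / q₁ * (1 / q₂) = 1 / q₁ by field_simp]
  rfl

lemma N_cyl_pos (d : ℕ) (hd : 1 ≤ d) (q₁ q₂ : ℝ) (h1 : 0 < q₁) (h2 : 0 < q₂) (ρ : ℝ) (hρ : 0 < ρ)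
    (z : Pt d) : MixedNorm d q₁ q₂ ((pCyl d ρ z).indicator 1) ≠ 0 := by
  rw [N_cyl d hd q₁ q₂ h1 h2 ρ hρ]
  have a := vB_pos d ρ hρ
  have b := vB_top d ρ
  have c := vI_pos ρ hρ
  refine mul_ne_zero ?_ ?_
  · simp [a, b]
  · rw [ne_eq, ENNReal.rpow_eq_zero_iff]
    rintro (h | h)
    · exact c h.1
    · exact ENNReal.ofReal_ne_top h.1

lemma N_cyl_top (d : ℕ) (hd : 1 ≤ d) (q₁ q₂ : ℝ) (h1 : 0 < q₁) (h2 : 0 < q₂) (ρ : ℝ) (hρ : 0 < ρ)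
    (z : Pt d) : MixedNorm d q₁ q₂ ((pCyl d ρ z).indicator 1) ≠ ∞ := by
  rw [N_cyl d hd q₁ q₂ h1 h2 ρ hρ]
  have b := vB_top d ρ
  have n1 : 0 ≤ 1 / q₁ := by positivity
  have n2 : 0 ≤ 1 / q₂ := by positivity
  finiteness

lemma N_cyl_two (d : ℕ) (hd : 1 ≤ d) (q₁ q₂ : ℝ) (h1 : 0 < q₁) (h2 : 0 < q₂) (ρ : ℝ) (hρ : 0 < ρ)
    (z : Pt d) :
    MixedNorm d q₁ q₂ ((pCyl d (2 * ρ) z).indicator 1) =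
      (((2:ℝ≥0∞) ^ d) ^ (1 / q₁) * 4 ^ (1 / q₂)) *
        MixedNorm d q₁ q₂ ((pCyl d ρ z).indicator 1) := by
  rw [N_cyl d hd q₁ q₂ h1 h2 ρ hρ, N_cyl d hd q₁ q₂ h1 h2 (2 * ρ) (by positivity)]
  have e1 : vB d (2 * ρ) = 2 ^ d * vB d ρ := by
    unfold vB
    rw [mul_pow, ENNReal.ofReal_mul (by positivity), ENNReal.ofReal_pow (by norm_num), mul_assoc]
    simp
  have e2 : ENNReal.ofReal ((2 * ρ) ^ 2) = 4 * ENNReal.ofReal (ρ ^ 2) := by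
    rw [mul_pow, ENNReal.ofReal_mul (by positivity)]; norm_num
  rw [e1, e2, ENNReal.mul_rpow_of_nonneg _ _ (by positivity),
    ENNReal.mul_rpow_of_nonneg _ _ (by positivity)]
  ring

lemma holder_set {X : Type*} [MeasurableSpace X] (μ : Measure X) (S : Set X) (q : ℝ) (hq : 1 < q)
    (g : X → ℝ≥0∞) (hg : Measurable g) :
    ∫⁻ x in S, g x ∂μ ≤ (∫⁻ x in S, g x ^ q ∂μ) ^ (1 / q) * μ S ^ (1 - 1 / q) := by
  have q0 : 0 < q := by linarith
  have n1 : 0 ≤ 1 / q := by positivity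
  have n2 : 0 ≤ 1 - 1 / q := by
    rw [sub_nonneg, div_le_one q0]; exact hq.le
  have := ENNReal.lintegral_mul_norm_pow_le (μ := μ.restrict S) (f := fun x => g x ^ q)
    (g := fun _ => 1) (hg.pow_const q).aemeasurable aemeasurable_const n1 n2 (by ring)
  simpa [← ENNReal.rpow_mul, q0.ne'] using this

lemma pAvg_le_mixed (d : ℕ) (hd : 1 ≤ d) (q₁ q₂ : ℝ) (h1 : 1 < q₁) (h2 : 1 < q₂) (ρ : ℝ)
    (hρ : 0 < ρ) (z : Pt d) (f : Pt d → ℝ≥0∞) (hf : Measurable f) :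
    pAvg d ρ z f ≤ MixedNormOn d q₁ q₂ (pCyl d ρ z) f := by
  have p1 : 0 < q₁ := by linarith
  have p2 : 0 < q₂ := by linarith
  unfold MixedNormOn
  rw [N_cyl d hd q₁ q₂ p1 p2 ρ hρ, MixedNorm_ind d q₁ q₂ p1 p2]
  unfold pAvg
  set I := Ico z.1 (z.1 + ρ ^ 2) with hI
  set B := Metric.ball z.2 ρ with hB
  have vI : volume I = ENNReal.ofReal (ρ ^ 2) := by simp [hI]
  have vBB : volume B = vB d ρ := vol_ball d hd _ _ hρ.le
  set i := ENNReal.ofReal (ρ ^ 2) with hi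
  set b := vB d ρ with hb
  have i0 : i ≠ 0 := vI_pos ρ hρ
  have it : i ≠ ∞ := ENNReal.ofReal_ne_top
  have b0 : b ≠ 0 := vB_pos d ρ hρ
  have bt : b ≠ ∞ := vB_top d ρ
  have hv : volume (pCyl d ρ z) = i * b := by
    rw [pCyl_eq, Measure.volume_eq_prod, Measure.prod_prod, vI, vBB]
  have mS : Measurable fun t : ℝ => ∫⁻ x in B, f (t, x) ^ q₁ :=
    Measurable.lintegral_prod_right' (f := fun p : ℝ × Ed d => f p ^ q₁) (hf.pow_const q₁)
  have hInt : ∫⁻ w in pCyl d ρ z, f w ≤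
      (∫⁻ t in I, (∫⁻ x in B, f (t, x) ^ q₁) ^ (q₂ / q₁)) ^ (1 / q₂) * i ^ (1 - 1 / q₂)
        * b ^ (1 - 1 / q₁) := by
    calc ∫⁻ w in pCyl d ρ z, f w = ∫⁻ t in I, ∫⁻ x in B, f (t, x) := by
          rw [pCyl_eq, Measure.volume_eq_prod, setLIntegral_prod _ hf.aemeasurable]
      _ ≤ ∫⁻ t in I, (∫⁻ x in B, f (t, x) ^ q₁) ^ (1 / q₁) * b ^ (1 - 1 / q₁) := by
          refine lintegral_mono fun t => ?_
          have sf : Measurable fun x : Ed d => f (t, x) := hf.comp measurable_prodMk_left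
          rw [← vBB]
          exact holder_set volume B q₁ h1 _ sf
      _ = (∫⁻ t in I, (∫⁻ x in B, f (t, x) ^ q₁) ^ (1 / q₁)) * b ^ (1 - 1 / q₁) :=
          lintegral_mul_const _ (mS.pow_const _)
      _ ≤ _ := by
          gcongr
          refine (holder_set volume I q₂ h2 _ (mS.pow_const _)).trans (le_of_eq ?_)
          simp only [← ENNReal.rpow_mul, show 1 / q₁ * q₂ = q₂ / q₁ by ring]
          rw [vI]
  set X := (∫⁻ t in I, (∫⁻ x in B, f (t, x) ^ q₁) ^ (q₂ / q₁)) ^ (1 / q₂)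
  rw [hv]
  have pw : ∀ y : ℝ≥0∞, y ≠ 0 → y ≠ ∞ → ∀ q : ℝ, y⁻¹ * y ^ (1 - 1 / q) = (y ^ (1 / q))⁻¹ := by
    intro y y0 yt q
    rw [← ENNReal.rpow_neg_one, ← ENNReal.rpow_add _ _ y0 yt, ← ENNReal.rpow_neg]
    congr 1; ring
  calc (i * b)⁻¹ * ∫⁻ w in pCyl d ρ z, f w
      ≤ (i * b)⁻¹ * (X * i ^ (1 - 1 / q₂) * b ^ (1 - 1 / q₁)) := by gcongr
    _ = (b⁻¹ * b ^ (1 - 1 / q₁)) * (i⁻¹ * i ^ (1 - 1 / q₂)) * X := by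
        rw [ENNReal.mul_inv (Or.inl i0) (Or.inl it)]; ring
    _ = _ := by
        rw [pw b b0 bt, pw i i0 it, ENNReal.mul_inv]
        · left; simp [b0, bt]
        · left
          have : 0 ≤ 1 / q₁ := by positivity
          finiteness

lemma stmt16_aux (d : ℕ) (hd : 1 ≤ d) (q₁ q₂ α β r₁ r₂ : ℝ) (hq₁ : 1 < q₁) (hq₂ : 1 < q₂)
    (hβ : 0 < β) (hβ' : β ≤ (d : ℝ) / q₁ + 2 / q₂) (hα : 0 < α) (hαβ : α < β)
    (hr₁ : r₁ * (β - α) = q₁ * β) (hr₂ : r₂ * (β - α) = q₂ * β) :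
    ∃ N : ℝ≥0∞, N ≠ ∞ ∧ ∀ f : Pt d → ℝ≥0∞, Measurable f →
      ∀ K : ℝ≥0∞, K = MixedMorrey d q₁ q₂ β univ f → K ≠ ∞ → ∀ (ρ : ℝ) (z₀ : Pt d), 0 < ρ →
      ENNReal.ofReal (ρ ^ (β - α)) * MixedNormOn d r₁ r₂ (pCyl d ρ z₀) (Palpha d α f) ≤ N * K := by
  have p1 : 0 < q₁ := by linarith
  have p2 : 0 < q₂ := by linarith
  have hba : 0 < β - α := by linarith
  have hαd : α < (d:ℝ) + 2 := by
    have a1 : (d:ℝ) / q₁ ≤ d := div_le_self (Nat.cast_nonneg d) hq₁.le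
    have a2 : 2 / q₂ ≤ 2 := div_le_self (by norm_num) hq₂.le
    linarith
  set θ := 1 - α / β with hθ
  have hθ' : θ = (β - α) / β := by rw [hθ]; field_simp
  have hθ0 : 0 < θ := by rw [hθ']; positivity
  have e1 : r₁ * θ = q₁ := by rw [hθ', ← mul_div_assoc, hr₁]; field_simp
  have e2 : r₂ * θ = q₂ := by rw [hθ', ← mul_div_assoc, hr₂]; field_simp
  have hαb0 : 0 < α / β := by positivity
  have hθ1 : θ ≤ 1 := by linarith
  have hr1 : 1 ≤ r₁ := by
    by_contra hcon
    push Not at hcon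
    nlinarith
  have hr2 : 1 ≤ r₂ := by
    by_contra hcon
    push Not at hcon
    nlinarith
  have pr1 : 0 < r₁ := by linarith
  have pr2 : 0 < r₂ := by linarith
  obtain ⟨C, hC, hpt⟩ := pointwise d hd α β hα hαβ hαd
  obtain ⟨Cm, hCm, hmax⟩ := mixed_max d hd q₁ q₂ hq₁ hq₂
  set c : ℝ≥0∞ := ((2:ℝ≥0∞) ^ d) ^ (1 / q₁) * 4 ^ (1 / q₂) with hc
  have hct : c ≠ ∞ := by
    have n1 : 0 ≤ 1 / q₁ := by positivity
    have n2 : 0 ≤ 1 / q₂ := by positivity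
    finiteness
  refine ⟨C * ((Cm * c) ^ θ + 1), by finiteness, fun f hf K hKdef hK ρ z₀ hρ => ?_⟩
  have hMor : ∀ (R : ℝ) (z : Pt d), 0 < R →
      ENNReal.ofReal (R ^ β) * MixedNormOn d q₁ q₂ (pCyl d R z) f ≤ K := by
    intro R z hR
    rw [hKdef]
    unfold MixedMorrey
    have := le_iSup₂_of_le (f := fun (ρ : ℝ) (_ : 0 < ρ) => ⨆ (z : Pt d) (_ : z ∈ univ),
      ENNReal.ofReal (ρ ^ β) * MixedNormOn d q₁ q₂ (pCyl d ρ z) (univ.indicator f)) R hR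
      (le_iSup₂_of_le (f := fun (z : Pt d) (_ : z ∈ univ) =>
      ENNReal.ofReal (R ^ β) * MixedNormOn d q₁ q₂ (pCyl d R z) (univ.indicator f)) z (mem_univ z)
      le_rfl)
    simpa only [indicator_univ] using this
  have hAvg : ∀ (R : ℝ) (z : Pt d), 0 < R → ENNReal.ofReal (R ^ β) * pAvg d R z f ≤ K :=
    fun R z hR => (mul_le_mul_right (pAvg_le_mixed d hd q₁ q₂ hq₁ hq₂ R hR z f hf) _).trans
      (hMor R z hR)
  set g := (pCyl d (2 * ρ) z₀).indicator f with hg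
  have hgm : Measurable g := hf.indicator (pCyl_meas d _ _)
  set n := MixedNorm d q₁ q₂ ((pCyl d ρ z₀).indicator 1) with hn
  have n0 : n ≠ 0 := N_cyl_pos d hd q₁ q₂ p1 p2 ρ hρ z₀
  have nt : n ≠ ∞ := N_cyl_top d hd q₁ q₂ p1 p2 ρ hρ z₀
  have hnr : MixedNorm d r₁ r₂ ((pCyl d ρ z₀).indicator 1) = n ^ θ := by
    rw [hn, ← MixedNorm_pow d q₁ q₂ r₁ r₂ θ p1 p2 hθ0 e1 e2]
    congr 1
    funext w
    by_cases hw : w ∈ pCyl d ρ z₀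
    · simp [indicator_of_mem hw]
    · simp [indicator_of_notMem hw, hθ0]
  have hgN : MixedNorm d q₁ q₂ g ≤ c * n * (ENNReal.ofReal (ρ ^ (-β)) * K) := by
    have a1 := hMor (2 * ρ) z₀ (by positivity)
    unfold MixedNormOn at a1
    rw [N_cyl_two d hd q₁ q₂ p1 p2 ρ hρ, ← hg, ← hc, ← hn] at a1
    have c0 : c ≠ 0 := by
      rw [hc]
      refine mul_ne_zero ?_ ?_
      · simp
      · simp
    have cn0 : c * n ≠ 0 := mul_ne_zero c0 n0
    have cnt : c * n ≠ ∞ := ENNReal.mul_ne_top hct nt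
    have a2 : ENNReal.ofReal (ρ ^ β) * ((c * n)⁻¹ * MixedNorm d q₁ q₂ g) ≤ K := by
      refine le_trans (mul_le_mul_left (ENNReal.ofReal_le_ofReal ?_) _) a1
      exact Real.rpow_le_rpow hρ.le (by linarith) hβ.le
    have hρβ : ENNReal.ofReal (ρ ^ (-β)) * ENNReal.ofReal (ρ ^ β) = 1 := by
      rw [← ENNReal.ofReal_mul (by positivity), ← Real.rpow_add hρ]; simp
    calc MixedNorm d q₁ q₂ g
        = ((c * n) * (c * n)⁻¹) * (ENNReal.ofReal (ρ ^ (-β)) * ENNReal.ofReal (ρ ^ β)) *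
            MixedNorm d q₁ q₂ g := by
          rw [ENNReal.mul_inv_cancel cn0 cnt, hρβ]; simp
      _ = c * n * (ENNReal.ofReal (ρ ^ (-β)) *
            (ENNReal.ofReal (ρ ^ β) * ((c * n)⁻¹ * MixedNorm d q₁ q₂ g))) := by ring
      _ ≤ _ := by gcongr
  set a := C * K ^ (α / β) with ha
  set b := C * K * ENNReal.ofReal (ρ ^ (α - β)) with hb
  have hat : a ≠ ∞ := by finiteness
  have hbt : b ≠ ∞ := by finiteness
  have hpM := pM_meas d hd g hgm
  have hmain : MixedNorm d r₁ r₂ ((pCyl d ρ z₀).indicator (Palpha d α f)) ≤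
      a * MixedNorm d q₁ q₂ (pM d g) ^ θ + b * n ^ θ := by
    calc MixedNorm d r₁ r₂ ((pCyl d ρ z₀).indicator (Palpha d α f))
        ≤ MixedNorm d r₁ r₂ (fun z => a * pM d g z ^ θ + b * (pCyl d ρ z₀).indicator 1 z) := by
          refine MixedNorm_mono d r₁ r₂ pr1 pr2 _ _ fun w => ?_
          by_cases hw : w ∈ pCyl d ρ z₀
          · rw [indicator_of_mem hw, indicator_of_mem hw, Pi.one_apply, mul_one]
            exact hpt f hf K hK hAvg ρ z₀ w hρ hw
          · rw [indicator_of_notMem hw]; exact zero_le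
      _ ≤ MixedNorm d r₁ r₂ (fun z => a * pM d g z ^ θ) +
          MixedNorm d r₁ r₂ (fun z => b * (pCyl d ρ z₀).indicator 1 z) :=
          MixedNorm_add d r₁ r₂ hr1 hr2 _ _ ((hpM.pow_const θ).const_mul a)
            ((measurable_one.indicator (pCyl_meas d _ _)).const_mul b)
      _ = _ := by
          rw [MixedNorm_smul d r₁ r₂ pr1 pr2 a hat, MixedNorm_smul d r₁ r₂ pr1 pr2 b hbt,
            MixedNorm_pow d q₁ q₂ r₁ r₂ θ p1 p2 hθ0 e1 e2, hnr]
  have hρθ : ENNReal.ofReal (ρ ^ (-β)) ^ θ = ENNReal.ofReal (ρ ^ (α - β)) := by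
    rw [ENNReal.ofReal_rpow_of_pos (by positivity), ← Real.rpow_mul hρ.le, hθ']
    congr 2; field_simp; ring
  have hKK : K ^ (α / β) * K ^ θ = K := by
    rw [← ENNReal.rpow_add_of_nonneg _ _ hαb0.le hθ0.le, hθ]; simp
  have hbound : a * MixedNorm d q₁ q₂ (pM d g) ^ θ + b * n ^ θ ≤
      C * ((Cm * c) ^ θ + 1) * K * (ENNReal.ofReal (ρ ^ (α - β)) * n ^ θ) := by
    calc a * MixedNorm d q₁ q₂ (pM d g) ^ θ + b * n ^ θ
        ≤ a * (Cm * (c * n * (ENNReal.ofReal (ρ ^ (-β)) * K))) ^ θ + b * n ^ θ := by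
          gcongr
          exact (hmax g hgm).trans (by gcongr)
      _ = a * ((Cm * c) ^ θ * n ^ θ * (ENNReal.ofReal (ρ ^ (α - β)) * K ^ θ)) + b * n ^ θ := by
          rw [show Cm * (c * n * (ENNReal.ofReal (ρ ^ (-β)) * K)) =
            (Cm * c) * n * (ENNReal.ofReal (ρ ^ (-β)) * K) by ring,
            ENNReal.mul_rpow_of_nonneg _ _ hθ0.le, ENNReal.mul_rpow_of_nonneg _ n hθ0.le,
            ENNReal.mul_rpow_of_nonneg _ K hθ0.le, hρθ]
      _ = C * (Cm * c) ^ θ * (K ^ (α / β) * K ^ θ) * (ENNReal.ofReal (ρ ^ (α - β)) * n ^ θ) +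
            C * K * (ENNReal.ofReal (ρ ^ (α - β)) * n ^ θ) := by rw [ha, hb]; ring
      _ = _ := by rw [hKK]; ring
  unfold MixedNormOn
  rw [hnr]
  have nθ0 : n ^ θ ≠ 0 := by simp [n0, nt]
  have nθt : n ^ θ ≠ ∞ := by finiteness
  have hρρ : ENNReal.ofReal (ρ ^ (β - α)) * ENNReal.ofReal (ρ ^ (α - β)) = 1 := by
    rw [← ENNReal.ofReal_mul (by positivity), ← Real.rpow_add hρ]; simp
  calc ENNReal.ofReal (ρ ^ (β - α)) * ((n ^ θ)⁻¹ *
        MixedNorm d r₁ r₂ ((pCyl d ρ z₀).indicator (Palpha d α f)))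
      ≤ ENNReal.ofReal (ρ ^ (β - α)) * ((n ^ θ)⁻¹ *
        (C * ((Cm * c) ^ θ + 1) * K * (ENNReal.ofReal (ρ ^ (α - β)) * n ^ θ))) := by
        gcongr
        exact hmain.trans hbound
    _ = (ENNReal.ofReal (ρ ^ (β - α)) * ENNReal.ofReal (ρ ^ (α - β))) * ((n ^ θ)⁻¹ * n ^ θ) *
        (C * ((Cm * c) ^ θ + 1) * K) := by ring
    _ = _ := by rw [hρρ, ENNReal.inv_mul_cancel nθ0 nθt]; simp

/-- Theorem 5.6: for `q₁, q₂ ∈ (1,∞)`, `0 < β ≤ d/q₁ + 2/q₂`,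
`α ∈ (0,β)` and `rᵢ(β−α) = qᵢβ`, one has `‖P_α f‖_{E_{r₁,r₂,β−α}} ≤ N ‖f‖_{E_{q₁,q₂,β}}`. -/
theorem stmt16 (d : ℕ) (hd : 1 ≤ d) (q₁ q₂ α β r₁ r₂ : ℝ) (hq₁ : 1 < q₁) (hq₂ : 1 < q₂)
    (hβ : 0 < β) (hβ' : β ≤ (d : ℝ) / q₁ + 2 / q₂) (hα : 0 < α) (hαβ : α < β)
    (hr₁ : r₁ * (β - α) = q₁ * β) (hr₂ : r₂ * (β - α) = q₂ * β) :
    ∃ N : ℝ, 0 < N ∧ ∀ f : Pt d → ℝ≥0∞, Measurable f →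
      MixedMorrey d r₁ r₂ (β - α) univ (Palpha d α f) ≤
        ENNReal.ofReal N * MixedMorrey d q₁ q₂ β univ f := by
  obtain ⟨N, hN, h⟩ := stmt16_aux d hd q₁ q₂ α β r₁ r₂ hq₁ hq₂ hβ hβ' hα hαβ hr₁ hr₂
  have hpos : 0 < N.toReal + 1 := by positivity
  refine ⟨N.toReal + 1, hpos, fun f hf => ?_⟩
  by_cases hK : MixedMorrey d q₁ q₂ β univ f = ∞
  · rw [hK, ENNReal.mul_top]
    · exact le_top
    · simp only [ne_eq, ENNReal.ofReal_eq_zero, not_le]; exact hpos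
  have hNle : N ≤ ENNReal.ofReal (N.toReal + 1) := by
    conv_lhs => rw [← ENNReal.ofReal_toReal hN]
    exact ENNReal.ofReal_le_ofReal (by linarith)
  conv_lhs => unfold MixedMorrey
  refine iSup_le fun ρ => iSup_le fun hρ => iSup_le fun z => iSup_le fun _ => ?_
  rw [indicator_univ]
  exact (h f hf _ rfl hK ρ z hρ).trans (mul_le_mul_left hNle _)

end
end

section
/- Let d ≥ 1, q_1, q_2 ∈ (1, ∞), 0 < β ≤ d/q_1 + 2/q_2. Then there exists a constant N = N(d, q_1, q_2, β) such that for every R ∈ (0, ∞), every ε ∈ (0, 1], and every u ∈ C_0^∞(ℝ^{d+1}), one has ‖Du‖_{E_{q_1,q_2,β}(C_R)} ≤ N ε R ‖ |∂_t u| + |D²u| ‖_{E_{q_1,q_2,β}(C_R)} + N ε^{-1} R^{-1} ‖u‖_{E_{q_1,q_2,β}(C_R)}. -/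
open MeasureTheory Set ENNReal Filter

noncomputable section

theorem mink {α S : Type*} [MeasurableSpace α] [MeasurableSpace S] (μ : Measure α) [SigmaFinite μ]
    (ν : Measure S) [SFinite ν] (p : ℝ) (hp : 1 < p) (F : S → α → ℝ≥0∞)
    (hF : Measurable (Function.uncurry F)) :
    (∫⁻ x, (∫⁻ s, F s x ∂ν) ^ p ∂μ) ^ (1 / p) ≤ ∫⁻ s, (∫⁻ x, F s x ^ p ∂μ) ^ (1 / p) ∂ν := by
  have hp0 : 0 < p := by linarith
  have hpq := Real.HolderConjugate.conjExponent hp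
  set q := p.conjExponent with hq
  have hq0 : 0 < q := hpq.symm.pos
  have hsum : 1 / p + 1 / q = 1 := by
    have := hpq.inv_add_inv_eq_one
    simpa [one_div] using this
  set Z := ∫⁻ s, (∫⁻ x, F s x ^ p ∂μ) ^ (1 / p) ∂ν with hZ
  rw [one_div, ENNReal.rpow_inv_le_iff hp0]
  by_contra hcon
  push Not at hcon
  have h1 := hcon
  rw [lintegral_eq_nnreal] at h1
  simp_rw [lt_iSup_iff] at h1
  obtain ⟨φ, hφ, hlt⟩ := h1
  rw [SimpleFunc.map_lintegral, ← SimpleFunc.map_lintegral, ← SimpleFunc.lintegral_eq_lintegral] at hlt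
  obtain ⟨g, hgφ, hgfin, hgL⟩ := exists_lt_lintegral_simpleFunc_of_lt_lintegral (f := φ) hlt
  have hgm : Measurable (fun x => (g x : ℝ≥0∞)) := g.measurable.coe_nnreal_ennreal
  set I := ∫⁻ x, (g x : ℝ≥0∞) ∂μ with hI
  have hI0 : I ≠ 0 := (lt_of_le_of_lt zero_le hgL).ne'
  have key : I ≤ Z * I ^ (1 / q) := by
    calc I = ∫⁻ x, (g x : ℝ≥0∞) ^ (1 / p) * (g x : ℝ≥0∞) ^ (1 / q) ∂μ := by
          refine lintegral_congr fun x => ?_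
          rw [← ENNReal.rpow_add_of_nonneg _ _ (by positivity) (by positivity), hsum, ENNReal.rpow_one]
      _ ≤ ∫⁻ x, (∫⁻ s, F s x ∂ν) * (g x : ℝ≥0∞) ^ (1 / q) ∂μ := by
          refine lintegral_mono fun x => ?_
          gcongr
          rw [one_div, ENNReal.rpow_inv_le_iff hp0]
          exact le_trans (by exact_mod_cast hgφ x) (hφ x)
      _ = ∫⁻ x, ∫⁻ s, F s x * (g x : ℝ≥0∞) ^ (1 / q) ∂ν ∂μ := by
          refine lintegral_congr fun x => ?_
          rw [lintegral_mul_const]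
          exact hF.comp (by fun_prop : Measurable fun s => (s, x))
      _ = ∫⁻ s, ∫⁻ x, F s x * (g x : ℝ≥0∞) ^ (1 / q) ∂μ ∂ν := by
          refine lintegral_lintegral_swap (Measurable.aemeasurable ?_)
          exact (hF.comp measurable_swap).mul ((hgm.comp measurable_fst).pow_const _)
      _ ≤ ∫⁻ s, (∫⁻ x, F s x ^ p ∂μ) ^ (1 / p) * I ^ (1 / q) ∂ν := by
          refine lintegral_mono fun s => ?_
          refine (ENNReal.lintegral_mul_le_Lp_mul_Lq μ hpq (f := F s)
            (g := fun x => (g x : ℝ≥0∞) ^ (1 / q))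
            (hF.comp (by fun_prop : Measurable fun x => (s, x))).aemeasurable
            (hgm.pow_const _).aemeasurable).trans (le_of_eq ?_)
          congr 2
          refine lintegral_congr fun x => ?_
          rw [← ENNReal.rpow_mul, one_div, inv_mul_cancel₀ hq0.ne', ENNReal.rpow_one]
      _ = Z * I ^ (1 / q) := by
          rw [lintegral_mul_const]
          exact (Measurable.lintegral_prod_right' (f := fun w : S × α => F w.1 w.2 ^ p)
            (hF.pow_const p)).pow_const _
  have h2 : I ^ (1 / p) * I ^ (1 / q) ≤ Z * I ^ (1 / q) := by
    rw [← ENNReal.rpow_add_of_nonneg _ _ (by positivity) (by positivity), hsum, ENNReal.rpow_one]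
    exact key
  have h3 : I ^ (1 / p) ≤ Z := by
    refine (ENNReal.mul_le_mul_iff_left ?_ ?_).1 h2
    · exact (ENNReal.rpow_pos (pos_iff_ne_zero.2 hI0) hgfin.ne).ne'
    · exact ENNReal.rpow_ne_top_of_nonneg (by positivity) hgfin.ne
  rw [one_div, ENNReal.rpow_inv_le_iff hp0] at h3
  exact absurd hgL (not_lt.2 h3)

theorem measurableSet_pCyl (d : ℕ) (ρ : ℝ) (z : Pt d) : MeasurableSet (pCyl d ρ z) := by
  have h1 : MeasurableSet {w : Pt d | dist z.2 w.2 < ρ} :=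
    measurableSet_lt (by fun_prop) (by fun_prop)
  have h2 : MeasurableSet {w : Pt d | z.1 ≤ w.1} := measurableSet_le (by fun_prop) (by fun_prop)
  have h3 : MeasurableSet {w : Pt d | w.1 < z.1 + ρ ^ 2} :=
    measurableSet_lt (by fun_prop) (by fun_prop)
  exact h1.inter (h2.inter h3)

theorem mixedNorm_mono (d : ℕ) {q₁ q₂ : ℝ} (hq₁ : 1 < q₁) (hq₂ : 1 < q₂) {f g : Pt d → ℝ≥0∞}
    (h : ∀ z, f z ≤ g z) : MixedNorm d q₁ q₂ f ≤ MixedNorm d q₁ q₂ g := by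
  unfold MixedNorm
  have h1 : 0 < q₁ := by linarith
  have h2 : 0 < q₂ := by linarith
  refine ENNReal.rpow_le_rpow (lintegral_mono fun t => ?_) (by positivity)
  refine ENNReal.rpow_le_rpow (lintegral_mono fun x => ?_) (by positivity)
  exact ENNReal.rpow_le_rpow (h _) h1.le

theorem mixedNorm_lintegral (d : ℕ) {q₁ q₂ : ℝ} (hq₁ : 1 < q₁) (hq₂ : 1 < q₂) {S : Type*}
    [MeasurableSpace S] (ν : Measure S) [SFinite ν] (F : S → Pt d → ℝ≥0∞)
    (hF : Measurable (Function.uncurry F)) :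
    MixedNorm d q₁ q₂ (fun z => ∫⁻ s, F s z ∂ν) ≤ ∫⁻ s, MixedNorm d q₁ q₂ (F s) ∂ν := by
  unfold MixedNorm
  have h1 : 0 < q₁ := by linarith
  have h2 : 0 < q₂ := by linarith
  have hB : ∀ A : ℝ≥0∞, A ^ (q₂ / q₁) = (A ^ (1 / q₁)) ^ q₂ := fun A => by
    rw [← ENNReal.rpow_mul]; congr 1; field_simp
  simp_rw [hB]
  refine le_trans ?_ (mink (volume : Measure ℝ) ν q₂ hq₂
    (fun s t => (∫⁻ x : Ed d, F s (t, x) ^ q₁) ^ (1 / q₁)) ?_)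
  · refine ENNReal.rpow_le_rpow (lintegral_mono fun t => ?_) (by positivity)
    refine ENNReal.rpow_le_rpow ?_ h2.le
    refine mink (volume : Measure (Ed d)) ν q₁ hq₁ (fun s x => F s (t, x)) ?_
    exact hF.comp (by fun_prop : Measurable fun w : S × Ed d => (w.1, (t, w.2)))
  · refine Measurable.pow_const ?_ _
    refine Measurable.lintegral_prod_right' (f := fun w : (S × ℝ) × Ed d => F w.1.1 (w.1.2, w.2) ^ q₁) ?_
    refine Measurable.pow_const ?_ _
    exact hF.comp (by fun_prop : Measurable fun w : (S × ℝ) × Ed d => (w.1.1, (w.1.2, w.2)))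

theorem measurable_mixedNorm (d : ℕ) (q₁ q₂ : ℝ) {S : Type*}
    [MeasurableSpace S] (F : S → Pt d → ℝ≥0∞)
    (hF : Measurable (Function.uncurry F)) : Measurable fun s => MixedNorm d q₁ q₂ (F s) := by
  unfold MixedNorm
  refine Measurable.pow_const ?_ _
  refine Measurable.lintegral_prod_right' (f := fun w : S × ℝ =>
    (∫⁻ x : Ed d, F w.1 (w.2, x) ^ q₁) ^ (q₂ / q₁)) ?_
  refine Measurable.pow_const ?_ _
  refine Measurable.lintegral_prod_right' (f := fun w : (S × ℝ) × Ed d =>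
    F w.1.1 (w.1.2, w.2) ^ q₁) ?_
  refine Measurable.pow_const ?_ _
  exact hF.comp (by fun_prop : Measurable fun w : (S × ℝ) × Ed d => (w.1.1, (w.1.2, w.2)))

theorem morrey_mono (d : ℕ) {q₁ q₂ : ℝ} (β : ℝ) (hq₁ : 1 < q₁) (hq₂ : 1 < q₂) (Q : Set (Pt d))
    {f g : Pt d → ℝ≥0∞}
    (h : ∀ z ∈ Q, f z ≤ g z) : MixedMorrey d q₁ q₂ β Q f ≤ MixedMorrey d q₁ q₂ β Q g := by
  unfold MixedMorrey MixedNormOn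
  refine iSup₂_mono fun ρ _ => iSup₂_mono fun z _ => ?_
  gcongr
  refine mixedNorm_mono d hq₁ hq₂ fun w => ?_
  refine Set.indicator_le_indicator ?_
  by_cases hw : w ∈ Q
  · simpa [hw] using h w hw
  · simp [hw]

theorem le_morrey (d : ℕ) (q₁ q₂ β : ℝ) (Q : Set (Pt d)) (f : Pt d → ℝ≥0∞) {ρ : ℝ} (hρ : 0 < ρ)
    {z : Pt d} (hz : z ∈ Q) :
    ENNReal.ofReal (ρ ^ β) * ((MixedNorm d q₁ q₂ ((pCyl d ρ z).indicator 1))⁻¹ *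
      MixedNorm d q₁ q₂ ((pCyl d ρ z).indicator (Q.indicator f))) ≤ MixedMorrey d q₁ q₂ β Q f := by
  unfold MixedMorrey
  refine le_trans ?_ (le_iSup₂ ρ hρ)
  refine le_trans ?_ (le_iSup₂ z hz)
  exact le_rfl

theorem morrey_lintegral (d : ℕ) {q₁ q₂ : ℝ} (β : ℝ) (hq₁ : 1 < q₁) (hq₂ : 1 < q₂) (Q : Set (Pt d))
    (hQ : MeasurableSet Q) {S : Type*}
    [MeasurableSpace S] (ν : Measure S) [SFinite ν] (F : S → Pt d → ℝ≥0∞)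
    (hF : Measurable (Function.uncurry F)) :
    MixedMorrey d q₁ q₂ β Q (fun z => ∫⁻ s, F s z ∂ν) ≤ ∫⁻ s, MixedMorrey d q₁ q₂ β Q (F s) ∂ν := by
  conv_lhs => unfold MixedMorrey
  refine iSup₂_le fun ρ hρ => iSup₂_le fun z hz => ?_
  set C := pCyl d ρ z with hC
  have hCm : MeasurableSet C := measurableSet_pCyl d ρ z
  have hmeas : Measurable (Function.uncurry fun s => C.indicator (Q.indicator (F s))) := by
    have : (Function.uncurry fun s => C.indicator (Q.indicator (F s))) =
        (Prod.snd ⁻¹' C : Set (S × Pt d)).indicator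
          ((Prod.snd ⁻¹' Q : Set (S × Pt d)).indicator (Function.uncurry F)) := by
      ext ⟨s, w⟩
      by_cases h1 : w ∈ C <;> by_cases h2 : w ∈ Q <;> simp [Set.indicator, h1, h2]
    rw [this]
    exact (hF.indicator (measurable_snd hQ)).indicator (measurable_snd hCm)
  have h1 : C.indicator (Q.indicator fun z => ∫⁻ s, F s z ∂ν) =
      fun z => ∫⁻ s, C.indicator (Q.indicator (F s)) z ∂ν := by
    ext w
    by_cases h1 : w ∈ C <;> by_cases h2 : w ∈ Q <;> simp [Set.indicator, h1, h2]
  unfold MixedNormOn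
  rw [h1]
  refine (mul_le_mul_right (mul_le_mul_right (mixedNorm_lintegral d hq₁ hq₂ ν _ hmeas) _) _).trans ?_
  have hnm : Measurable fun s => MixedNorm d q₁ q₂ (C.indicator (Q.indicator (F s))) :=
    measurable_mixedNorm d q₁ q₂ _ hmeas
  rw [← lintegral_const_mul _ hnm, ← lintegral_const_mul _ (hnm.const_mul _)]
  refine lintegral_mono fun s => ?_
  exact le_morrey d q₁ q₂ β Q (F s) hρ hz

theorem morrey_sum (d : ℕ) {q₁ q₂ : ℝ} (β : ℝ) (hq₁ : 1 < q₁) (hq₂ : 1 < q₂) (Q : Set (Pt d))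
    (hQ : MeasurableSet Q) {n : ℕ} (F : Fin n → Pt d → ℝ≥0∞) (hF : ∀ i, Measurable (F i)) :
    MixedMorrey d q₁ q₂ β Q (fun z => ∑ i, F i z) ≤ ∑ i, MixedMorrey d q₁ q₂ β Q (F i) := by
  have := morrey_lintegral d β hq₁ hq₂ Q hQ (Measure.count : Measure (Fin n)) F
    (measurable_from_prod_countable_right hF)
  simpa [lintegral_fintype] using this

theorem morrey_add (d : ℕ) {q₁ q₂ : ℝ} (β : ℝ) (hq₁ : 1 < q₁) (hq₂ : 1 < q₂) (Q : Set (Pt d))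
    (hQ : MeasurableSet Q) (f g : Pt d → ℝ≥0∞) (hf : Measurable f) (hg : Measurable g) :
    MixedMorrey d q₁ q₂ β Q (fun z => f z + g z) ≤
      MixedMorrey d q₁ q₂ β Q f + MixedMorrey d q₁ q₂ β Q g := by
  have := morrey_sum d β hq₁ hq₂ Q hQ ![f, g] (by intro i; fin_cases i <;> simpa)
  simpa using this

theorem mixedNorm_const_mul (d : ℕ) {q₁ q₂ : ℝ} (hq₁ : 1 < q₁) (hq₂ : 1 < q₂) (c : ℝ≥0∞)
    (hc : c ≠ ∞) (f : Pt d → ℝ≥0∞) :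
    MixedNorm d q₁ q₂ (fun z => c * f z) = c * MixedNorm d q₁ q₂ f := by
  unfold MixedNorm
  have h1 : 0 < q₁ := by linarith
  have h2 : 0 < q₂ := by linarith
  have e : ∀ t, (∫⁻ x : Ed d, (c * f (t, x)) ^ q₁) ^ (q₂ / q₁) =
      c ^ q₂ * (∫⁻ x : Ed d, (f (t, x)) ^ q₁) ^ (q₂ / q₁) := fun t => by
    simp_rw [ENNReal.mul_rpow_of_nonneg _ _ h1.le]
    rw [lintegral_const_mul' _ _ (ENNReal.rpow_ne_top_of_nonneg h1.le hc),
      ENNReal.mul_rpow_of_nonneg _ _ (by positivity), ← ENNReal.rpow_mul]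
    congr 2; field_simp
  simp_rw [e]
  rw [lintegral_const_mul' _ _ (ENNReal.rpow_ne_top_of_nonneg h2.le hc),
      ENNReal.mul_rpow_of_nonneg _ _ (by positivity), ← ENNReal.rpow_mul]
  rw [mul_one_div_cancel h2.ne', ENNReal.rpow_one]

theorem morrey_const_mul (d : ℕ) {q₁ q₂ : ℝ} (β : ℝ) (hq₁ : 1 < q₁) (hq₂ : 1 < q₂) (Q : Set (Pt d))
    (c : ℝ≥0∞) (hc : c ≠ ∞) (f : Pt d → ℝ≥0∞) :
    MixedMorrey d q₁ q₂ β Q (fun z => c * f z) = c * MixedMorrey d q₁ q₂ β Q f := by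
  unfold MixedMorrey MixedNormOn
  simp_rw [ENNReal.mul_iSup]
  have e : ∀ C : Set (Pt d), C.indicator (Q.indicator fun z => c * f z) =
      fun z => c * C.indicator (Q.indicator f) z := fun C => by
    ext w
    by_cases h1 : w ∈ C <;> by_cases h2 : w ∈ Q <;> simp [Set.indicator, h1, h2]
  simp_rw [e, mixedNorm_const_mul d hq₁ hq₂ c hc]
  refine iSup_congr fun ρ => iSup_congr fun _ => iSup_congr fun z => iSup_congr fun _ => ?_
  rw [mul_left_comm c, mul_left_comm c]

/-- The contraction towards `y`. -/
def contr (d : ℕ) (y : Ed d) (s : ℝ) (z : Pt d) : Pt d := (z.1, z.2 + s • (y - z.2))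

theorem contr_mem (d : ℕ) {R : ℝ} {y : Ed d} (hy : ‖y‖ < R) {s : ℝ} (hs : 0 ≤ s) (hs' : s ≤ 1 / 2)
    {z : Pt d} (hz : z ∈ pCyl d R 0) : contr d y s z ∈ pCyl d R 0 := by
  obtain ⟨h1, h2⟩ := hz
  refine ⟨?_, h2⟩
  simp only [contr, Prod.snd_zero, dist_zero_left] at h1 ⊢
  have : z.2 + s • (y - z.2) = (1 - s) • z.2 + s • y := by
    rw [smul_sub, sub_smul, one_smul]; abel
  rw [this]
  refine (norm_add_le _ _).trans_lt ?_
  rw [norm_smul, norm_smul, Real.norm_of_nonneg hs, Real.norm_of_nonneg (by linarith)]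
  nlinarith [norm_nonneg y]

theorem mixedNorm_cyl (d : ℕ) (q₁ q₂ ρ t : ℝ) (x x' : Ed d) :
    MixedNorm d q₁ q₂ ((pCyl d ρ (t, x)).indicator 1) =
      MixedNorm d q₁ q₂ ((pCyl d ρ (t, x')).indicator 1) := by
  unfold MixedNorm
  congr 1
  refine lintegral_congr fun τ => ?_
  congr 1
  rw [← lintegral_add_right_eq_self _ (x - x')]
  refine lintegral_congr fun y => ?_
  congr 1
  have : ((τ, y + (x - x')) ∈ pCyl d ρ (t, x)) ↔ ((τ, y) ∈ pCyl d ρ (t, x')) := by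
    simp only [pCyl, Set.mem_ofPred_eq, dist_eq_norm]
    rw [show x - (y + (x - x')) = x' - y by abel]
  by_cases h : (τ, y) ∈ pCyl d ρ (t, x')
  · rw [Set.indicator_of_mem h, Set.indicator_of_mem (this.2 h)]; rfl
  · rw [Set.indicator_of_notMem h, Set.indicator_of_notMem (fun h' => h (this.1 h'))]

theorem lintegral_contr (d : ℕ) (y : Ed d) {s : ℝ} (hs' : s ≤ 1 / 2)
    (g : Ed d → ℝ≥0∞) (hg : Measurable g) :
    ∫⁻ x : Ed d, g (x + s • (y - x)) ≤ ENNReal.ofReal (2 ^ d) * ∫⁻ x, g x := by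
  have hpos : 0 < 1 - s := by linarith
  have e : ∀ x : Ed d, x + s • (y - x) = (1 - s) • x + s • y := fun x => by
    rw [smul_sub, sub_smul, one_smul]; abel
  simp_rw [e]
  have h1 : ∫⁻ x : Ed d, g ((1 - s) • x + s • y) =
      ∫⁻ x, g (x + s • y) ∂(Measure.map (fun x : Ed d => (1 - s) • x) volume) := by
    rw [lintegral_map (by fun_prop) (by fun_prop)]
  rw [h1, Measure.map_addHaar_smul _ hpos.ne', lintegral_smul_measure,
    lintegral_add_right_eq_self, smul_eq_mul, finrank_euclideanSpace, Fintype.card_fin]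
  gcongr
  rw [abs_of_pos (by positivity), ← inv_pow]
  gcongr
  rw [inv_le_comm₀ hpos (by norm_num)]
  linarith

theorem morrey_contr (d : ℕ) {q₁ q₂ : ℝ} (β : ℝ) (hq₁ : 1 < q₁) (hq₂ : 1 < q₂) {R : ℝ}
    {y : Ed d} (hy : ‖y‖ < R) {s : ℝ} (hs : 0 ≤ s) (hs' : s ≤ 1 / 2) (f : Pt d → ℝ≥0∞)
    (hf : Measurable f) :
    MixedMorrey d q₁ q₂ β (pCyl d R 0) (fun z => f (contr d y s z)) ≤
      ENNReal.ofReal (2 ^ d) * MixedMorrey d q₁ q₂ β (pCyl d R 0) f := by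
  have h1 : 0 < q₁ := by linarith
  have h2 : 0 < q₂ := by linarith
  conv_lhs => unfold MixedMorrey
  refine iSup₂_le fun ρ hρ => iSup₂_le fun z hz => ?_
  set Q := pCyl d R 0 with hQ
  have hQm : MeasurableSet Q := measurableSet_pCyl d R 0
  refine le_trans ?_ (mul_le_mul_right (le_morrey d q₁ q₂ β Q f hρ (contr_mem d hy hs hs' hz)) _)
  unfold MixedNormOn
  have hcyl : MixedNorm d q₁ q₂ ((pCyl d ρ (contr d y s z)).indicator 1) =
      MixedNorm d q₁ q₂ ((pCyl d ρ z).indicator 1) :=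
    mixedNorm_cyl d q₁ q₂ ρ z.1 (contr d y s z).2 z.2
  rw [mul_left_comm (ENNReal.ofReal (2 ^ d)), mul_left_comm (ENNReal.ofReal (2 ^ d)), hcyl]
  refine mul_le_mul_right (mul_le_mul_right ?_ _) _
  set g := (pCyl d ρ (contr d y s z)).indicator (Q.indicator f) with hg
  have hgm : Measurable g := (hf.indicator hQm).indicator (measurableSet_pCyl _ _ _)
  have hpt : ∀ w, (pCyl d ρ z).indicator (Q.indicator fun z => f (contr d y s z)) w ≤
      g (contr d y s w) := by
    intro w
    by_cases hw : w ∈ pCyl d ρ z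
    · by_cases hwQ : w ∈ Q
      · have hw1 : contr d y s w ∈ Q := contr_mem d hy hs hs' hwQ
        have hw2 : contr d y s w ∈ pCyl d ρ (contr d y s z) := by
          refine ⟨?_, hw.2⟩
          have := hw.1
          simp only [contr, dist_eq_norm] at this ⊢
          rw [show z.2 + s • (y - z.2) - (w.2 + s • (y - w.2)) = (1 - s) • (z.2 - w.2) by
            simp only [smul_sub, sub_smul, one_smul]; abel, norm_smul,
            Real.norm_of_nonneg (by linarith)]
          nlinarith [norm_nonneg (z.2 - w.2)]
        simp [hg, hw, hwQ, hw1, hw2]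
      · simp [hw, hwQ]
    · simp [hw]
  refine (mixedNorm_mono d hq₁ hq₂ hpt).trans ?_
  unfold MixedNorm
  set c := ENNReal.ofReal (2 ^ d) with hc
  have hct : c ≠ ∞ := ENNReal.ofReal_ne_top
  have hc1 : 1 ≤ c := by
    rw [hc, ← ENNReal.ofReal_one]
    exact ENNReal.ofReal_le_ofReal (one_le_pow₀ (by norm_num))
  have e : ∀ t : ℝ, (∫⁻ x : Ed d, g (contr d y s (t, x)) ^ q₁) ^ (q₂ / q₁) ≤
      c ^ (q₂ / q₁) * (∫⁻ x : Ed d, g (t, x) ^ q₁) ^ (q₂ / q₁) := fun t => by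
    rw [← ENNReal.mul_rpow_of_nonneg _ _ (by positivity)]
    refine ENNReal.rpow_le_rpow ?_ (by positivity)
    exact lintegral_contr d y hs' (fun x => g (t, x) ^ q₁)
      ((hgm.comp (by fun_prop : Measurable fun x : Ed d => (t, x))).pow_const _)
  refine (ENNReal.rpow_le_rpow (lintegral_mono e) (by positivity)).trans ?_
  rw [lintegral_const_mul' _ _ (ENNReal.rpow_ne_top_of_nonneg (by positivity) hct),
      ENNReal.mul_rpow_of_nonneg _ _ (by positivity), ← ENNReal.rpow_mul]
  refine mul_le_mul_left ?_ _
  calc c ^ (q₂ / q₁ * (1 / q₂)) ≤ c ^ (1 : ℝ) := by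
        refine ENNReal.rpow_le_rpow_of_exponent_le hc1 ?_
        rw [show q₂ / q₁ * (1 / q₂) = 1 / q₁ by field_simp, div_le_one h1]
        exact hq₁.le
    _ = c := ENNReal.rpow_one c

theorem taylor_bound (f f' f'' : ℝ → ℝ) (hf : ∀ s, HasDerivAt f (f' s) s)
    (hf' : ∀ s, HasDerivAt f' (f'' s) s) (hc : Continuous f'') {a : ℝ} (ha : 0 < a) :
    |f' 0| ≤ a⁻¹ * (|f a| + |f 0|) + ∫ s in Ioc 0 a, |f'' s| := by
  obtain ⟨c, hcm, hcd⟩ := exists_hasDerivAt_eq_slope f f' ha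
    (fun s _ => (hf s).continuousAt.continuousWithinAt) (fun s _ => hf s)
  have h1 : f' c - f' 0 = ∫ s in (0 : ℝ)..c, f'' s :=
    (intervalIntegral.integral_eq_sub_of_hasDerivAt (fun s _ => hf' s)
      (hc.intervalIntegrable _ _)).symm
  have h2 : |f' c - f' 0| ≤ ∫ s in Ioc 0 a, |f'' s| := by
    rw [h1]
    refine (intervalIntegral.abs_integral_le_integral_abs hcm.1.le).trans ?_
    rw [intervalIntegral.integral_of_le hcm.1.le]
    refine setIntegral_mono_set ?_ (ae_of_all _ fun s => abs_nonneg _)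
      (Ioc_subset_Ioc_right hcm.2.le).eventuallyLE
    exact (hc.abs.integrableOn_Icc).mono_set Ioc_subset_Icc_self
  have h3 : |f' c| ≤ a⁻¹ * (|f a| + |f 0|) := by
    rw [hcd, sub_zero, abs_div, abs_of_pos ha, div_eq_inv_mul]
    gcongr
    exact abs_sub _ _
  have := abs_sub_abs_le_abs_sub (f' 0) (f' c)
  rw [abs_sub_comm] at this
  linarith

theorem fderiv_space (d : ℕ) (u : Pt d → ℝ) (z : Pt d) (v : Ed d) :
    fderiv ℝ u z (0, v) = ∑ i, v i * spDeriv d i u z := by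
  have h : ((0 : ℝ), v) = ∑ i, v i • ((0 : ℝ), EuclideanSpace.single i (1 : ℝ)) := by
    ext1
    · simp [Prod.fst_sum]
    · rw [Prod.snd_sum]
      ext j
      simp [Finset.sum_apply, Pi.single_apply]
  rw [h, map_sum]
  refine Finset.sum_congr rfl fun i _ => ?_
  rw [map_smul]
  rfl

theorem contDiff_spDeriv (d : ℕ) (i : Fin d) {u : Pt d → ℝ} (hu : ContDiff ℝ (⊤ : ℕ∞) u) :
    ContDiff ℝ (⊤ : ℕ∞) (spDeriv d i u) := by
  unfold spDeriv
  exact (hu.fderiv_right (m := (⊤ : ℕ∞)) (by simp)).clm_apply contDiff_const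

theorem hasDerivAt_line (d : ℕ) {u : Pt d → ℝ} (hu : ContDiff ℝ (⊤ : ℕ∞) u) (y : Ed d) (z : Pt d)
    (s : ℝ) : HasDerivAt (fun s => u (contr d y s z))
      (∑ i, (y - z.2) i * spDeriv d i u (contr d y s z)) s := by
  rw [← fderiv_space]
  have hd : DifferentiableAt ℝ u (contr d y s z) := hu.differentiable (by simp) _
  refine hd.hasFDerivAt.comp_hasDerivAt s ?_
  unfold contr
  refine (hasDerivAt_const s z.1).prodMk ?_
  simpa using ((hasDerivAt_id s).smul_const (y - z.2)).const_add z.2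

theorem abs_le_hess (d : ℕ) (u : Pt d → ℝ) (z : Pt d) (i j : Fin d) :
    |spDeriv d i (spDeriv d j u) z| ≤ hessNorm d u z := by
  unfold hessNorm
  refine Real.abs_le_sqrt ?_
  refine (Finset.single_le_sum (f := fun j => spDeriv d i (spDeriv d j u) z ^ 2)
    (fun _ _ => sq_nonneg _) (Finset.mem_univ j)).trans ?_
  exact (Finset.single_le_sum (f := fun i => ∑ j, spDeriv d i (spDeriv d j u) z ^ 2)
    (fun _ _ => Finset.sum_nonneg fun _ _ => sq_nonneg _) (Finset.mem_univ i))

theorem continuous_contr (d : ℕ) (y : Ed d) :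
    Continuous (fun w : ℝ × Pt d => contr d y w.1 w.2) := by
  unfold contr
  fun_prop

theorem continuous_hess (d : ℕ) {u : Pt d → ℝ} (hu : ContDiff ℝ (⊤ : ℕ∞) u) :
    Continuous (hessNorm d u) := by
  unfold hessNorm
  refine Real.continuous_sqrt.comp ?_
  refine continuous_finsetSum _ fun i _ => continuous_finsetSum _ fun j _ => ?_
  exact (contDiff_spDeriv d i (contDiff_spDeriv d j hu)).continuous.pow 2

/-- The one-direction interpolation bound. -/
theorem dir_bound (d : ℕ) {u : Pt d → ℝ} (hu : ContDiff ℝ (⊤ : ℕ∞) u) {R : ℝ} {y : Ed d}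
    (hy : ‖y‖ < R) {z : Pt d} (hz : z ∈ pCyl d R 0) {a : ℝ} (ha : 0 < a) :
    |∑ i, (y - z.2) i * spDeriv d i u z| ≤ a⁻¹ * (|u (contr d y a z)| + |u z|) +
      ∫ s in Ioc 0 a, 4 * R ^ 2 * d ^ 2 * hessNorm d u (contr d y s z) := by
  have hz0 : contr d y 0 z = z := by simp [contr]
  have hzR : ‖z.2‖ < R := by simpa using hz.1
  have hR : 0 < R := (norm_nonneg _).trans_lt hy
  have hv : ‖y - z.2‖ ≤ 2 * R := (norm_sub_le _ _).trans (by linarith)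
  have hvi : ∀ i, |(y - z.2) i| ≤ 2 * R := fun i => (PiLp.norm_apply_le (y - z.2) i).trans hv
  have hcz : Continuous fun s => contr d y s z :=
    (continuous_contr d y).comp (by fun_prop : Continuous fun s : ℝ => (s, z))
  have hcc : Continuous fun s => ∑ i, (y - z.2) i *
      ∑ j, (y - z.2) j * spDeriv d j (spDeriv d i u) (contr d y s z) := by
    refine continuous_finsetSum _ fun i _ => continuous_const.mul
      (continuous_finsetSum _ fun j _ => continuous_const.mul ?_)
    exact (contDiff_spDeriv d j (contDiff_spDeriv d i hu)).continuous.comp hcz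
  have := taylor_bound (fun s => u (contr d y s z))
    (fun s => ∑ i, (y - z.2) i * spDeriv d i u (contr d y s z))
    (fun s => ∑ i, (y - z.2) i * ∑ j, (y - z.2) j * spDeriv d j (spDeriv d i u) (contr d y s z))
    (hasDerivAt_line d hu y z)
    (fun s => HasDerivAt.fun_sum fun i _ =>
      (hasDerivAt_line d (contDiff_spDeriv d i hu) y z s).const_mul _) hcc ha
  simp only [hz0] at this
  refine this.trans ?_
  refine add_le_add le_rfl ?_
  have hc2 : Continuous fun s => 4 * R ^ 2 * d ^ 2 * hessNorm d u (contr d y s z) :=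
    continuous_const.mul ((continuous_hess d hu).comp hcz)
  refine setIntegral_mono (μ := volume) (hcc.abs.integrableOn_Icc.mono_set Ioc_subset_Icc_self)
    (hc2.integrableOn_Icc.mono_set Ioc_subset_Icc_self) fun s => ?_
  have hh : 0 ≤ hessNorm d u (contr d y s z) := Real.sqrt_nonneg _
  calc |∑ i, (y - z.2) i * ∑ j, (y - z.2) j * spDeriv d j (spDeriv d i u) (contr d y s z)|
      ≤ ∑ i : Fin d, 2 * R * ∑ j : Fin d, 2 * R * hessNorm d u (contr d y s z) := by
        refine (Finset.abs_sum_le_sum_abs _ _).trans (Finset.sum_le_sum fun i _ => ?_)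
        rw [abs_mul]
        gcongr
        · exact hvi i
        refine (Finset.abs_sum_le_sum_abs _ _).trans (Finset.sum_le_sum fun j _ => ?_)
        rw [abs_mul]
        gcongr
        · exact hvi j
        · exact abs_le_hess d u _ j i
    _ = 4 * R ^ 2 * d ^ 2 * hessNorm d u (contr d y s z) := by
        simp only [Finset.sum_const, Finset.card_univ, Fintype.card_fin, nsmul_eq_mul]
        ring

theorem grad_bound (d : ℕ) (u : Pt d → ℝ) (z : Pt d) :
    gradNorm d u z ≤ ∑ i, |spDeriv d i u z| := by
  unfold gradNorm
  refine Real.sqrt_le_iff.2 ⟨Finset.sum_nonneg fun _ _ => abs_nonneg _, ?_⟩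
  simp_rw [← sq_abs (spDeriv d _ u z)]
  exact Finset.sum_sq_le_sq_sum_of_nonneg fun _ _ => abs_nonneg _

theorem coord_bound (d : ℕ) (u : Pt d → ℝ) (z : Pt d) (i : Fin d) {R : ℝ} (hR : 0 < R) :
    |spDeriv d i u z| ≤ 2 / R *
      (|∑ j, ((EuclideanSpace.single i (R / 2) : Ed d) - z.2) j * spDeriv d j u z| +
        |∑ j, ((0 : Ed d) - z.2) j * spDeriv d j u z|) := by
  have h : spDeriv d i u z = 2 / R *
      ((∑ j, ((EuclideanSpace.single i (R / 2) : Ed d) - z.2) j * spDeriv d j u z) -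
        ∑ j, ((0 : Ed d) - z.2) j * spDeriv d j u z) := by
    rw [← Finset.sum_sub_distrib]
    simp_rw [← sub_mul]
    have : ∀ j, ((EuclideanSpace.single i (R / 2) : Ed d) - z.2) j - ((0 : Ed d) - z.2) j =
      if j = i then R / 2 else 0 := fun j => by simp
    simp_rw [this]
    simp
    field_simp
  conv_lhs => rw [h]
  rw [abs_mul, abs_of_pos (by positivity)]
  gcongr
  exact abs_sub _ _

/-- The majorant of the derivative of `u` in the direction of `y`. -/
def majo (d : ℕ) (R a : ℝ) (U G : Pt d → ℝ≥0∞) (y : Ed d) (z : Pt d) : ℝ≥0∞ :=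
  ENNReal.ofReal a⁻¹ * (U (contr d y a z) + U z) +
    ENNReal.ofReal (4 * R ^ 2 * d ^ 2) * ∫⁻ s in Ioc 0 a, G (contr d y s z)

theorem measurable_contr_comp (d : ℕ) (G : Pt d → ℝ≥0∞) (hG : Measurable G) (y : Ed d) :
    Measurable (Function.uncurry fun (s : ℝ) z => G (contr d y s z)) :=
  hG.comp (continuous_contr d y).measurable

theorem measurable_contr_comp' (d : ℕ) (G : Pt d → ℝ≥0∞) (hG : Measurable G) (y : Ed d) (a : ℝ) :
    Measurable (fun z => G (contr d y a z)) :=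
  (measurable_contr_comp d G hG y).comp (by fun_prop : Measurable fun z : Pt d => (a, z))

theorem measurable_majo_int (d : ℕ) (a : ℝ) (G : Pt d → ℝ≥0∞)
    (hG : Measurable G) (y : Ed d) :
    Measurable (fun z => ∫⁻ s in Ioc 0 a, G (contr d y s z)) :=
  Measurable.lintegral_prod_left (μ := volume.restrict (Ioc 0 a)) (measurable_contr_comp d G hG y)

theorem measurable_majo (d : ℕ) (R a : ℝ) (U G : Pt d → ℝ≥0∞) (hU : Measurable U)
    (hG : Measurable G) (y : Ed d) : Measurable (majo d R a U G y) := by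
  unfold majo
  exact (((measurable_contr_comp' d U hU y a).add hU).const_mul _).add
    ((measurable_majo_int d a G hG y).const_mul _)

theorem morrey_majo (d : ℕ) {q₁ q₂ : ℝ} (β : ℝ) (hq₁ : 1 < q₁) (hq₂ : 1 < q₂) {R a : ℝ}
    (ha : 0 < a) (ha' : a ≤ 1 / 2) (U G : Pt d → ℝ≥0∞) (hU : Measurable U)
    (hG : Measurable G) (y : Ed d) (hy : ‖y‖ < R) :
    MixedMorrey d q₁ q₂ β (pCyl d R 0) (majo d R a U G y) ≤
      ENNReal.ofReal a⁻¹ * (ENNReal.ofReal (2 ^ d) * MixedMorrey d q₁ q₂ β (pCyl d R 0) U +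
        MixedMorrey d q₁ q₂ β (pCyl d R 0) U) + ENNReal.ofReal (4 * R ^ 2 * d ^ 2) *
        (ENNReal.ofReal (2 ^ d) * MixedMorrey d q₁ q₂ β (pCyl d R 0) G * ENNReal.ofReal a) := by
  have hQm := measurableSet_pCyl d R 0
  have hUa := measurable_contr_comp' d U hU y a
  have hGi := measurable_majo_int d a G hG y
  unfold majo
  refine (morrey_add d β hq₁ hq₂ _ hQm _ _ ((hUa.add hU).const_mul _) (hGi.const_mul _)).trans ?_
  rw [morrey_const_mul d β hq₁ hq₂ _ _ ENNReal.ofReal_ne_top,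
    morrey_const_mul d β hq₁ hq₂ _ _ ENNReal.ofReal_ne_top]
  gcongr
  · refine (morrey_add d β hq₁ hq₂ _ hQm _ _ hUa hU).trans ?_
    gcongr
    exact morrey_contr d β hq₁ hq₂ hy ha.le ha' U hU
  · refine (morrey_lintegral d β hq₁ hq₂ _ hQm (volume.restrict (Ioc 0 a))
      (fun s z => G (contr d y s z)) (measurable_contr_comp d G hG y)).trans ?_
    refine (setLIntegral_mono' measurableSet_Ioc (g := fun _ => ENNReal.ofReal (2 ^ d) *
      MixedMorrey d q₁ q₂ β (pCyl d R 0) G) fun s hs => ?_).trans ?_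
    · exact morrey_contr d β hq₁ hq₂ hy hs.1.le (hs.2.trans ha') G hG
    · rw [setLIntegral_const, Real.volume_Ioc, sub_zero]

theorem dir_bound' (d : ℕ) {u : Pt d → ℝ} (hu : ContDiff ℝ (⊤ : ℕ∞) u) {R : ℝ} {y : Ed d}
    (hy : ‖y‖ < R) {z : Pt d} (hz : z ∈ pCyl d R 0) {a : ℝ} (ha : 0 < a) :
    ENNReal.ofReal |∑ i, (y - z.2) i * spDeriv d i u z| ≤
      majo d R a (fun z => ENNReal.ofReal |u z|)
        (fun z => ENNReal.ofReal (|timeDeriv d u z| + hessNorm d u z)) y z := by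
  have hR : 0 < R := (norm_nonneg _).trans_lt hy
  have hcz : Continuous fun s => contr d y s z :=
    (continuous_contr d y).comp (by fun_prop : Continuous fun s : ℝ => (s, z))
  have hc2 : Continuous fun s => hessNorm d u (contr d y s z) := (continuous_hess d hu).comp hcz
  refine (ENNReal.ofReal_le_ofReal (dir_bound d hu hy hz ha)).trans ?_
  refine ENNReal.ofReal_add_le.trans ?_
  unfold majo
  refine add_le_add ?_ ?_
  · rw [ENNReal.ofReal_mul (by positivity), ENNReal.ofReal_add (abs_nonneg _) (abs_nonneg _)]
  · rw [integral_const_mul, ENNReal.ofReal_mul (by positivity)]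
    gcongr
    rw [ofReal_integral_eq_lintegral_ofReal (hc2.integrableOn_Icc.mono_set Ioc_subset_Icc_self)
      (ae_of_all _ fun s => Real.sqrt_nonneg _)]
    refine lintegral_mono fun s => ENNReal.ofReal_le_ofReal ?_
    exact le_add_of_nonneg_left (abs_nonneg _)

/-- Lemma 5.10: for `q₁, q₂ ∈ (1,∞)`, `0 < β ≤ d/q₁ + 2/q₂` there is
`N = N(d,q₁,q₂,β)` such that for all `R ∈ (0,∞)`, `ε ∈ (0,1]`, `u ∈ C_0^∞`,
`‖Du‖_{E(C_R)} ≤ N ε R ‖|∂_t u|+|D²u|‖_{E(C_R)} + N ε⁻¹ R⁻¹ ‖u‖_{E(C_R)}`. -/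
theorem stmt18 (d : ℕ) (hd : 1 ≤ d) (q₁ q₂ β : ℝ) (hq₁ : 1 < q₁) (hq₂ : 1 < q₂)
    (hβ : 0 < β) (hβ' : β ≤ (d : ℝ) / q₁ + 2 / q₂) :
    ∃ N : ℝ, 0 < N ∧ ∀ R : ℝ, 0 < R → ∀ ε : ℝ, 0 < ε → ε ≤ 1 →
      ∀ u : Pt d → ℝ, ContDiff ℝ (⊤ : ℕ∞) u → HasCompactSupport u →
        MixedMorrey d q₁ q₂ β (pCyl d R 0) (fun z => ENNReal.ofReal (gradNorm d u z)) ≤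
          ENNReal.ofReal (N * ε * R) * MixedMorrey d q₁ q₂ β (pCyl d R 0)
              (fun z => ENNReal.ofReal (|timeDeriv d u z| + hessNorm d u z)) +
            ENNReal.ofReal (N * ε⁻¹ * R⁻¹) * MixedMorrey d q₁ q₂ β (pCyl d R 0)
              (fun z => ENNReal.ofReal |u z|) := by
  have hd1 : (1 : ℝ) ≤ d := by exact_mod_cast hd
  have hd0 : (0 : ℝ) < d := by linarith
  refine ⟨8 * d ^ 3 * (2 ^ d + 1), by positivity, ?_⟩
  intro R hR ε hε hε1 u hu _
  set U : Pt d → ℝ≥0∞ := fun z => ENNReal.ofReal |u z| with hUdef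
  set G : Pt d → ℝ≥0∞ := fun z => ENNReal.ofReal (|timeDeriv d u z| + hessNorm d u z) with hGdef
  have hU : Measurable U := by
    exact ENNReal.measurable_ofReal.comp hu.continuous.abs.measurable
  have hT : Continuous (timeDeriv d u) := by
    unfold timeDeriv
    exact (hu.continuous_fderiv (by simp)).clm_apply continuous_const
  have hG : Measurable G :=
    ENNReal.measurable_ofReal.comp (hT.abs.add (continuous_hess d hu)).measurable
  set a := ε / 2 with ha
  have ha0 : 0 < a := by positivity
  have ha1 : a ≤ 1 / 2 := by linarith
  have hQm := measurableSet_pCyl d R 0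
  have hy1 : ∀ i : Fin d, ‖(EuclideanSpace.single i (R / 2) : Ed d)‖ < R := fun i => by
    rw [EuclideanSpace.norm_single, Real.norm_of_nonneg (by positivity)]
    linarith
  have hy0 : ‖(0 : Ed d)‖ < R := by simpa using hR
  have hpt : ∀ z ∈ pCyl d R 0, ENNReal.ofReal (gradNorm d u z) ≤
      ∑ i : Fin d, ENNReal.ofReal (2 / R) *
        (majo d R a U G (EuclideanSpace.single i (R / 2)) z + majo d R a U G 0 z) := by
    intro z hz
    refine (ENNReal.ofReal_le_ofReal (grad_bound d u z)).trans ?_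
    rw [ENNReal.ofReal_sum_of_nonneg fun _ _ => abs_nonneg _]
    refine Finset.sum_le_sum fun i _ => ?_
    refine (ENNReal.ofReal_le_ofReal (coord_bound d u z i hR)).trans ?_
    rw [ENNReal.ofReal_mul (by positivity), ENNReal.ofReal_add (abs_nonneg _) (abs_nonneg _)]
    gcongr
    · exact dir_bound' d hu (hy1 i) hz ha0
    · exact dir_bound' d hu hy0 hz ha0
  refine (morrey_mono d β hq₁ hq₂ _ hpt).trans ?_
  have hm := measurable_majo d R a U G hU hG
  refine (morrey_sum d β hq₁ hq₂ _ hQm _ fun i => ((hm _).add (hm _)).const_mul _).trans ?_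
  set MU := MixedMorrey d q₁ q₂ β (pCyl d R 0) U
  set MG := MixedMorrey d q₁ q₂ β (pCyl d R 0) G
  set K := ENNReal.ofReal a⁻¹ * (ENNReal.ofReal (2 ^ d) * MU + MU) +
    ENNReal.ofReal (4 * R ^ 2 * d ^ 2) * (ENNReal.ofReal (2 ^ d) * MG * ENNReal.ofReal a) with hK
  calc _ ≤ ∑ _i : Fin d, ENNReal.ofReal (2 / R) * (K + K) := by
        refine Finset.sum_le_sum fun i _ => ?_
        rw [morrey_const_mul d β hq₁ hq₂ _ _ ENNReal.ofReal_ne_top]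
        gcongr
        refine (morrey_add d β hq₁ hq₂ _ hQm _ _ (hm _) (hm _)).trans ?_
        exact add_le_add (morrey_majo d β hq₁ hq₂ ha0 ha1 U G hU hG _ (hy1 i))
          (morrey_majo d β hq₁ hq₂ ha0 ha1 U G hU hG _ hy0)
    _ = ENNReal.ofReal (d * (4 / R) * (4 * R ^ 2 * d ^ 2) * 2 ^ d * a) * MG +
        ENNReal.ofReal (d * (4 / R) * a⁻¹ * (2 ^ d + 1)) * MU := by
        have e1 : ENNReal.ofReal (d * (4 / R) * (4 * R ^ 2 * d ^ 2) * 2 ^ d * a) =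
            d * (2 * ENNReal.ofReal (2 / R)) * ENNReal.ofReal (4 * R ^ 2 * d ^ 2) *
              ENNReal.ofReal (2 ^ d) * ENNReal.ofReal a := by
          rw [ENNReal.ofReal_mul (by positivity), ENNReal.ofReal_mul (by positivity),
            ENNReal.ofReal_mul (by positivity), ENNReal.ofReal_mul (by positivity),
            ENNReal.ofReal_natCast, show 4 / R = 2 * (2 / R) by ring,
            ENNReal.ofReal_mul (by positivity), ENNReal.ofReal_ofNat]
        have e2 : ENNReal.ofReal (d * (4 / R) * a⁻¹ * (2 ^ d + 1)) =
            d * (2 * ENNReal.ofReal (2 / R)) * ENNReal.ofReal a⁻¹ *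
              (ENNReal.ofReal (2 ^ d) + 1) := by
          rw [ENNReal.ofReal_mul (by positivity), ENNReal.ofReal_mul (by positivity),
            ENNReal.ofReal_mul (by positivity), ENNReal.ofReal_add (by positivity) (by positivity),
            ENNReal.ofReal_natCast, show 4 / R = 2 * (2 / R) by ring,
            ENNReal.ofReal_mul (by positivity), ENNReal.ofReal_ofNat, ENNReal.ofReal_one]
        rw [e1, e2, hK]
        simp only [Finset.sum_const, Finset.card_univ, Fintype.card_fin, nsmul_eq_mul]
        ring
    _ ≤ _ := by
        have hd3 : (d : ℝ) ≤ d ^ 3 := le_self_pow₀ hd1 (by norm_num)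
        refine add_le_add (mul_le_mul_left (ENNReal.ofReal_le_ofReal ?_) _)
          (mul_le_mul_left (ENNReal.ofReal_le_ofReal ?_) _)
        · rw [show (d : ℝ) * (4 / R) * (4 * R ^ 2 * d ^ 2) * 2 ^ d * a =
            8 * d ^ 3 * 2 ^ d * ε * R by rw [ha]; field_simp; ring]
          gcongr
          linarith
        · rw [show (d : ℝ) * (4 / R) * a⁻¹ * (2 ^ d + 1) =
            8 * d * (2 ^ d + 1) * ε⁻¹ * R⁻¹ by rw [ha]; field_simp; ring]
          gcongr
end
end
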